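/- arXiv:2502.06013 — 2 statements merged into one kernel-verified Lean document; each statement's English description precedes it below -/
import Mathlib

section
/- Let H be a graph and m ≥ 3, and let G be a wedge of H with the complete graph K_m, where v₁,...,v_m are the vertices of K_m and v₁ is the vertex of K_m identified with a vertex of H. If D₀ = (v,i,ε) is a state in which the stone coexists with the replica of some vertex v_j with j ≥ 2 (i.e., v⁻¹(i + (1−ε)/2) = v_j), then the orbit of Θ_G containing D₀ has winding vector 0. -/
open scoped Classical

/-- The state space `Ξₙ` for a graph on vertex set `V` with `n = |V|`: a state `(v, i, ε)`
consists of a bijection `v` from the vertices to the positions `ℤ/n` (the replica of vertex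
`a` sits at position `v a`; positions increase clockwise), the index `i : ℤ/n`, and the
orientation `ε ∈ {±1}` encoded as a `Bool` (`true` = `+1`, `false` = `-1`). -/
abbrev Xi (V : Type*) [Fintype V] : Type _ :=
  (V ≃ ZMod (Fintype.card V)) × ZMod (Fintype.card V) × Bool

/-- The orientation `ε` as an element of `ℤ/n`. -/
def epsZ (n : ℕ) (e : Bool) : ZMod n := if e then 1 else -1

/-- Refractive toric promotion `Θ_G`:
`Θ_G (v,i,ε) = (s̄ᵢ v, i+ε, ε)` if `{v⁻¹(i), v⁻¹(i+1)}` is not an edge of `G`, and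
`Θ_G (v,i,ε) = (s̄ᵢ v, i−ε, −ε)` if it is an edge of `G`.  Here `s̄ᵢ v` swaps the replicas
sitting at positions `i` and `i+1`. -/
noncomputable def theta {V : Type*} [Fintype V] (G : SimpleGraph V) (D : Xi V) : Xi V :=
  if G.Adj (D.1.symm D.2.1) (D.1.symm (D.2.1 + 1)) then
    (D.1.trans (Equiv.swap D.2.1 (D.2.1 + 1)), D.2.1 - epsZ _ D.2.2, !D.2.2)
  else
    (D.1.trans (Equiv.swap D.2.1 (D.2.1 + 1)), D.2.1 + epsZ _ D.2.2, D.2.2)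

/-- The net number of clockwise steps that the replica of vertex `a` makes during one
application of `Θ_G` to the state `D`: each application swaps the replicas at positions
`i` and `i+1`, moving the former one step clockwise and the latter one step
counterclockwise. -/
def disp {V : Type*} [Fintype V] (D : Xi V) (a : V) : ℤ :=
  if D.1 a = D.2.1 then 1 else if D.1 a = D.2.1 + 1 then -1 else 0

/-- `n` times the winding number `w_O(a)` of vertex `a` with respect to the orbit `O` of the
state `D` under `Θ_G`: the net number of clockwise steps made by the replica of `a` during
`P` consecutive applications of `Θ_G` starting from `D`, where `P` is the size of the orbit
(i.e. the minimal period of `D`).  The winding number itself is `windSum G D a / n`; in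
particular `w_O(a) = 0` iff `windSum G D a = 0`, and `w_O(a) = w_O(b)` iff
`windSum G D a = windSum G D b`. -/
noncomputable def windSum {V : Type*} [Fintype V] (G : SimpleGraph V) (D : Xi V) (a : V) : ℤ :=
  ∑ k ∈ Finset.range (Function.minimalPeriod (theta G) D), disp ((theta G)^[k] D) a

/-- The winding vector of the orbit of `D` under `Θ_G` is zero. -/
def WindingVectorZero {V : Type*} [Fintype V] (G : SimpleGraph V) (D : Xi V) : Prop :=
  ∀ a : V, windSum G D a = 0

/-- The vertex whose replica coexists with the stone (the replica at position
`i + (1-ε)/2`). -/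
noncomputable def stoneVertex {V : Type*} [Fintype V] (D : Xi V) : V :=
  D.1.symm (if D.2.2 then D.2.1 else D.2.1 + 1)

/-- The wedge of `G₁` and `G₂` at vertices `v₁` and `v₂`: the graph obtained from the
disjoint union of `G₁` and `G₂` by identifying `v₁` with `v₂`.  Its vertex set is
`V₁ ⊕ {y : V₂ // y ≠ v₂}`, the identified vertex being `Sum.inl v₁`. -/
def wedge {V₁ V₂ : Type*} [DecidableEq V₂] (G₁ : SimpleGraph V₁) (G₂ : SimpleGraph V₂)
    (v₁ : V₁) (v₂ : V₂) : SimpleGraph (V₁ ⊕ {y : V₂ // y ≠ v₂}) :=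
  SimpleGraph.fromRel (fun x y =>
    match x, y with
    | Sum.inl a, Sum.inl b => G₁.Adj a b
    | Sum.inl a, Sum.inr b => a = v₁ ∧ G₂.Adj v₂ b.1
    | Sum.inr a, Sum.inr b => G₂.Adj a.1 b.1
    | Sum.inr _, Sum.inl _ => False)

namespace RTP

variable {W : Type*} [Fintype W]

/-- Stone position. -/
def pos (D : Xi W) : ZMod (Fintype.card W) := if D.2.2 then D.2.1 else D.2.1 + 1

/-- Direction. -/
def dir (D : Xi W) : ZMod (Fintype.card W) := epsZ _ D.2.2

/-- Integer direction. -/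
def sgn (D : Xi W) : ℤ := if D.2.2 then 1 else -1

/-- Vertex about to be met. -/
noncomputable def tgt (D : Xi W) : W := D.1.symm (pos D + dir D)

lemma stone_eq (D : Xi W) : stoneVertex D = D.1.symm (pos D) := rfl

lemma sgn_cast (D : Xi W) : ((sgn D : ℤ) : ZMod (Fintype.card W)) = dir D := by
  unfold sgn dir epsZ; split_ifs <;> simp

lemma sgn_cases (D : Xi W) : sgn D = 1 ∨ sgn D = -1 := by
  unfold sgn; split_ifs <;> simp

lemma adj_iff (G : SimpleGraph W) (D : Xi W) :
    G.Adj (D.1.symm D.2.1) (D.1.symm (D.2.1 + 1)) ↔ G.Adj (stoneVertex D) (tgt D) := by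
  obtain ⟨v, i, e⟩ := D
  cases e
  · simp [stone_eq, tgt, pos, dir, epsZ, G.adj_comm]
  · simp [stone_eq, tgt, pos, dir, epsZ]

lemma theta_fst (G : SimpleGraph W) (D : Xi W) :
    (theta G D).1 = D.1.trans (Equiv.swap (pos D) (pos D + dir D)) := by
  obtain ⟨v, i, e⟩ := D
  unfold theta
  cases e
  · have : Equiv.swap (i + 1) i = Equiv.swap i (i + 1) := Equiv.swap_comm _ _
    split_ifs <;> simp [pos, dir, epsZ, this]
  · split_ifs <;> simp [pos, dir, epsZ]

lemma theta_adj (G : SimpleGraph W) (D : Xi W) (h : G.Adj (stoneVertex D) (tgt D)) :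
    pos (theta G D) = pos D ∧ (theta G D).2.2 = !D.2.2 := by
  rw [← adj_iff] at h
  unfold theta
  rw [if_pos h]
  obtain ⟨v, i, e⟩ := D
  cases e <;> simp [pos, epsZ]

lemma theta_nadj (G : SimpleGraph W) (D : Xi W) (h : ¬ G.Adj (stoneVertex D) (tgt D)) :
    pos (theta G D) = pos D + dir D ∧ (theta G D).2.2 = D.2.2 := by
  rw [← adj_iff] at h
  unfold theta
  rw [if_neg h]
  obtain ⟨v, i, e⟩ := D
  cases e <;> simp [pos, epsZ, dir]

lemma stone_adj (G : SimpleGraph W) (D : Xi W) (h : G.Adj (stoneVertex D) (tgt D)) :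
    stoneVertex (theta G D) = tgt D := by
  rw [stone_eq, (theta_adj G D h).1, theta_fst, tgt]
  simp

lemma stone_nadj (G : SimpleGraph W) (D : Xi W) (h : ¬ G.Adj (stoneVertex D) (tgt D)) :
    stoneVertex (theta G D) = stoneVertex D := by
  rw [stone_eq, (theta_nadj G D h).1, theta_fst, stone_eq]
  simp

section big
variable (hn : 3 ≤ Fintype.card W)
include hn

lemma one_ne : (1 : ZMod (Fintype.card W)) ≠ 0 := by
  have : Fact (1 < Fintype.card W) := ⟨by omega⟩
  exact one_ne_zero

lemma dir_ne (D : Xi W) : dir D ≠ 0 := by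
  have := one_ne hn
  unfold dir epsZ; split_ifs <;> simpa

lemma stone_ne_tgt (D : Xi W) : stoneVertex D ≠ tgt D := by
  rw [stone_eq, tgt]
  intro h
  have := D.1.symm.injective h
  exact dir_ne hn D (by simpa using this)

lemma disp_stone (D : Xi W) : disp D (stoneVertex D) = sgn D := by
  have := one_ne hn
  obtain ⟨v, i, e⟩ := D
  cases e <;> simp [disp, stone_eq, pos, sgn, this]

lemma disp_tgt (D : Xi W) : disp D (tgt D) = - sgn D := by
  have := one_ne hn
  obtain ⟨v, i, e⟩ := D
  cases e <;> simp [disp, tgt, pos, sgn, dir, epsZ, this]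

omit hn in
lemma disp_other (D : Xi W) (a : W) (h1 : a ≠ stoneVertex D) (h2 : a ≠ tgt D) : disp D a = 0 := by
  obtain ⟨v, i, e⟩ := D
  rw [stone_eq, ne_eq, Equiv.eq_symm_apply] at h1
  rw [tgt, ne_eq, Equiv.eq_symm_apply] at h2
  cases e <;> simp_all [disp, pos, dir, epsZ]

/-- integer lift of positions -/
def IsLift (f : W → ℤ) (D : Xi W) : Prop := ∀ a, ((f a : ℤ) : ZMod (Fintype.card W)) = D.1 a

lemma lift_step (G : SimpleGraph W) (f : W → ℤ) (D : Xi W) (h : IsLift f D) :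
    IsLift (fun a => f a + disp D a) (theta G D) := by
  intro a
  rw [theta_fst]
  push_cast
  rw [h a]
  by_cases h1 : a = stoneVertex D
  · subst h1
    rw [disp_stone hn, sgn_cast, stone_eq]; simp
  by_cases h2 : a = tgt D
  · subst h2
    rw [disp_tgt hn, Int.cast_neg, sgn_cast, tgt]; simp
  rw [disp_other D a h1 h2]
  rw [stone_eq, Equiv.eq_symm_apply] at h1
  rw [tgt, Equiv.eq_symm_apply] at h2
  simp [Equiv.swap_apply_of_ne_of_ne h1 h2]

omit hn in
lemma lift_inj (f : W → ℤ) (D : Xi W) (h : IsLift f D) (a b : W)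
    (hab : ((f a : ℤ) : ZMod (Fintype.card W)) = (f b : ℤ)) : a = b := by
  rw [h a, h b] at hab
  exact D.1.injective hab

/-- The invariant. -/
def Inv (K : W → Prop) (u : W) (D : Xi W) (f : W → ℤ) : Prop :=
  IsLift f D ∧ ∃ x y z, K x ∧ K y ∧ K z ∧ f x < f y ∧ f y < f z ∧ f z < f x + Fintype.card W ∧
    (∀ w, K w → w ≠ x → w ≠ y → f z ≤ f w ∧ f w < f x + Fintype.card W) ∧
    (K (stoneVertex D) → stoneVertex D = y) ∧ (¬ K (stoneVertex D) → u = y)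

lemma inv_step (G : SimpleGraph W) (K : W → Prop) (u : W)
    (hcl : ∀ a b, K a → K b → a ≠ b → G.Adj a b)
    (hcut : ∀ a b, K a → ¬ K b → G.Adj a b → a = u)
    (D : Xi W) (f : W → ℤ) (h : Inv K u D f) :
    Inv K u (theta G D) (fun a => f a + disp D a) := by
  obtain ⟨hl, x, y, z, Kx, Ky, Kz, hxy, hyz, hzx, hw, hs1, hs2⟩ := h
  have hl' := lift_step hn G f D hl
  refine ⟨hl', ?_⟩
  have hds := disp_stone hn D
  have hdt := disp_tgt hn D
  have hdo := disp_other D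
  have hst := stone_ne_tgt hn D
  set s := stoneVertex D with hs
  set t := tgt D with ht
  by_cases hK : K s ∧ K t
  · obtain ⟨Ks, Kt⟩ := hK
    have hadj := hcl s t Ks Kt hst
    have hst' : stoneVertex (theta G D) = t := stone_adj G D hadj
    have hsy := hs1 Ks
    have hft : ((f t : ℤ) : ZMod (Fintype.card W)) = ((f s + sgn D : ℤ) : ZMod (Fintype.card W)) := by
      push_cast
      rw [hl, hl, sgn_cast, ht, hs, tgt, stone_eq]; simp
    have hft2 : f t = f s + sgn D := by
      rw [ZMod.intCast_eq_intCast_iff] at hft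
      obtain ⟨k, hk⟩ := hft.dvd
      have hb : f x ≤ f t ∧ f t < f x + Fintype.card W := by
        by_cases h1 : t = x
        · subst h1; constructor <;> omega
        · have := hw t Kt h1 (fun h => hst (hsy.trans h.symm))
          constructor <;> omega
      have hb2 : f x ≤ f s + sgn D ∧ f s + sgn D < f x + Fintype.card W := by
        rw [hsy]
        rcases sgn_cases D with h | h <;> rw [h] <;> constructor <;> omega
      have hk0 : k = 0 := by
        by_contra hk0
        rcases lt_or_gt_of_ne hk0 with h | h
        · nlinarith
        · nlinarith
      subst hk0
      omega
    rw [hst']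
    rcases sgn_cases D with he | he <;> rw [he] at hft2 hds hdt
    · have htz : t = z := by
        by_contra hne
        have hts : t ≠ y := fun h => hst (hsy.trans h.symm)
        have htx : t ≠ x := by
          intro h; rw [h, hsy] at hft2; omega
        have h1 := hw t Kt htx hts
        have h2 : f t = f z := by rw [hsy] at hft2; omega
        exact hne (lift_inj f D hl t z (by rw [h2]))
      have hzx' : z ≠ x := by rintro rfl; omega
      have hxy' : x ≠ y := by rintro rfl; omega
      have hdx : disp D x = 0 := hdo x (by rw [hsy]; exact hxy') (by rw [htz]; exact hzx'.symm)
      rw [hsy] at hds hft2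
      rw [htz] at hdt hft2
      refine ⟨x, z, y, Kx, Kz, Ky, ?_, ?_, ?_, ?_, fun _ => htz, fun h => absurd Kt h⟩
      · simp only [hdx, hdt]; omega
      · simp only [hds, hdt]; omega
      · simp only [hds, hdx]; omega
      · intro w Kw hwx hwz
        by_cases hwy : w = y
        · subst hwy; simp only [hds, hdx]; constructor <;> omega
        · have := hw w Kw hwx hwy
          have hd : disp D w = 0 := hdo w (by rw [hsy]; exact hwy) (by rw [htz]; exact hwz)
          simp only [hds, hdx, hd]; constructor <;> omega
    · have htx : t = x := by
        by_contra hne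
        have hts : t ≠ y := fun h => hst (hsy.trans h.symm)
        have h1 := hw t Kt hne hts
        rw [hsy] at hft2; omega
      have hzx' : z ≠ x := by rintro rfl; omega
      have hzy' : z ≠ y := by rintro rfl; omega
      have hdz : disp D z = 0 := hdo z (by rw [hsy]; exact hzy') (by rw [htx]; exact hzx')
      rw [hsy] at hds hft2
      rw [htx] at hdt hft2
      refine ⟨y, x, z, Ky, Kx, Kz, ?_, ?_, ?_, ?_, fun _ => htx, fun h => absurd Kt h⟩
      · simp only [hds, hdt]; omega
      · simp only [hdz, hdt]; omega
      · simp only [hds, hdz]; omega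
      · intro w Kw hwy hwx
        have := hw w Kw hwx hwy
        have hd : disp D w = 0 := hdo w (by rw [hsy]; exact hwy) (by rw [htx]; exact hwx)
        simp only [hds, hdz, hd]; constructor <;> omega
  · -- at most one clique vertex moves
    have key : ∀ a b, K a → K b → disp D a - disp D b ≤ 1 := by
      intro a b Ka Kb
      rcases sgn_cases D with he | he <;> rw [he] at hds hdt <;>
      by_cases h1 : a = s <;> by_cases h2 : a = t <;> by_cases h3 : b = s <;> by_cases h4 : b = t <;>
      first
      | (exfalso; grind)
      | grind
    have k0 : ∀ a b, K a → K b → f a < f b → f a + disp D a < f b + disp D b := by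
      intro a b Ka Kb hab
      have h1 := key a b Ka Kb
      have h2 : f a + disp D a ≠ f b + disp D b := by
        intro h
        have := lift_inj _ _ hl' a b (by simp only [h])
        subst this; omega
      omega
    have k1 : ∀ a b, K a → K b → a ≠ b → f a < f b + Fintype.card W →
        f a + disp D a < f b + disp D b + Fintype.card W := by
      intro a b Ka Kb hne hab
      have h1 := key a b Ka Kb
      have h2 : f a + disp D a ≠ f b + disp D b + Fintype.card W := by
        intro h
        refine hne (lift_inj _ _ hl' a b ?_)
        simp only [h]
        push_cast; simp
      omega
    have hzx' : z ≠ x := by rintro rfl; omega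
    refine ⟨x, y, z, Kx, Ky, Kz, k0 _ _ Kx Ky hxy, k0 _ _ Ky Kz hyz, k1 _ _ Kz Kx hzx' hzx, ?_, ?_⟩
    · intro w Kw hwx hwy
      have := hw w Kw hwx hwy
      refine ⟨?_, k1 _ _ Kw Kx hwx this.2⟩
      by_cases hwz : w = z
      · subst hwz; exact le_rfl
      · refine (k0 _ _ Kz Kw (lt_of_le_of_ne this.1 ?_)).le
        intro h
        exact hwz (lift_inj f D hl w z (by rw [h]))
    · by_cases hadj : G.Adj s t
      · rw [show stoneVertex (theta G D) = t from stone_adj G D hadj]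
        by_cases Ks : K s
        · have Kt : ¬ K t := fun h => hK ⟨Ks, h⟩
          have := hcut s t Ks Kt hadj
          exact ⟨fun h => absurd h Kt, fun _ => this ▸ hs1 Ks⟩
        · refine ⟨fun Kt => ?_, fun _ => hs2 Ks⟩
          rw [hcut t s Kt Ks hadj.symm]; exact hs2 Ks
      · rw [show stoneVertex (theta G D) = s from stone_nadj G D hadj]
        exact ⟨hs1, hs2⟩

/-- partial sums -/
noncomputable def S (G : SimpleGraph W) (D : Xi W) (N : ℕ) (a : W) : ℤ :=
  ∑ k ∈ Finset.range N, disp ((theta G)^[k] D) a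

omit hn in
lemma S_add (G : SimpleGraph W) (D : Xi W) (M N : ℕ) (a : W) :
    S G D (M + N) a = S G D M a + S G ((theta G)^[M] D) N a := by
  unfold S
  rw [Finset.sum_range_add]
  congr 1
  refine Finset.sum_congr rfl fun k _ => ?_
  rw [← Function.iterate_add_apply, add_comm]

omit hn in
lemma S_mul (G : SimpleGraph W) (D : Xi W) (P : ℕ) (hP : (theta G)^[P] D = D) (N : ℕ) (a : W) :
    S G D (N * P) a = N * S G D P a := by
  induction N with
  | zero => simp [S]
  | succ N ih =>
    rw [Nat.succ_mul, Nat.add_comm, S_add, hP, ih]; push_cast; ring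

omit hn in
lemma S_shift (G : SimpleGraph W) (D : Xi W) (P : ℕ) (hP : (theta G)^[P] D = D) (k : ℕ) (a : W) :
    S G ((theta G)^[k] D) P a = S G D P a := by
  have h1 := S_add G D k P a
  have h2 := S_add G D P k a
  rw [hP, Nat.add_comm] at h2
  linarith

omit hn in
lemma per_shift (G : SimpleGraph W) (D : Xi W) (P : ℕ) (hP : (theta G)^[P] D = D) (k : ℕ) :
    (theta G)^[P] ((theta G)^[k] D) = (theta G)^[k] D := by
  rw [← Function.iterate_add_apply, add_comm, Function.iterate_add_apply, hP]

lemma inv_iter (G : SimpleGraph W) (K : W → Prop) (u : W)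
    (hcl : ∀ a b, K a → K b → a ≠ b → G.Adj a b)
    (hcut : ∀ a b, K a → ¬ K b → G.Adj a b → a = u)
    (D : Xi W) (f : W → ℤ) (h : Inv K u D f) (N : ℕ) :
    Inv K u ((theta G)^[N] D) (fun a => f a + S G D N a) := by
  induction N with
  | zero => simpa [S] using h
  | succ N ih =>
    have := inv_step hn G K u hcl hcut _ _ ih
    rw [← Function.iterate_succ_apply' (theta G) N D] at this
    convert this using 2
    unfold S
    rw [Finset.sum_range_succ]; ring

omit hn in
lemma inv_bound (K : W → Prop) (u : W) (D : Xi W) (f : W → ℤ) (h : Inv K u D f) (a b : W)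
    (Ka : K a) (Kb : K b) : f a - f b < Fintype.card W := by
  obtain ⟨hl, x, y, z, Kx, Ky, Kz, hxy, hyz, hzx, hw, hs1, hs2⟩ := h
  have : ∀ w, K w → f x ≤ f w ∧ f w < f x + Fintype.card W := by
    intro w Kw
    by_cases h1 : w = x
    · subst h1; constructor <;> omega
    by_cases h2 : w = y
    · subst h2; constructor <;> omega
    have := hw w Kw h1 h2
    constructor <;> omega
  have h1 := this a Ka
  have h2 := this b Kb
  omega

lemma S_eq (G : SimpleGraph W) (K : W → Prop) (u : W)
    (hcl : ∀ a b, K a → K b → a ≠ b → G.Adj a b)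
    (hcut : ∀ a b, K a → ¬ K b → G.Adj a b → a = u)
    (D : Xi W) (f : W → ℤ) (h : Inv K u D f) (P : ℕ) (hP : (theta G)^[P] D = D)
    (a b : W) (Ka : K a) (Kb : K b) : S G D P a = S G D P b := by
  have main : ∀ a b, K a → K b → S G D P a ≤ S G D P b := by
    intro a b Ka Kb
    by_contra hlt
    push Not at hlt
    have h1 := inv_bound K u _ _ (inv_iter hn G K u hcl hcut D f h (2 * Fintype.card W * P)) a b Ka Kb
    have h2 := inv_bound K u _ _ h b a Kb Ka
    simp only [S_mul G D P hP] at h1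
    push_cast at h1
    nlinarith
  exact le_antisymm (main a b Ka Kb) (main b a Kb Ka)

/-- Reversal composed with a relabelling. -/
noncomputable def Phi (σ : Equiv.Perm W) (D : Xi W) : Xi W :=
  (σ.trans D.1, D.2.1 - epsZ _ D.2.2, !D.2.2)

omit hn in
lemma theta_phi (G : SimpleGraph W) (σ : Equiv.Perm W)
    (hσ : ∀ a b, G.Adj (σ a) (σ b) ↔ G.Adj a b) (D : Xi W) :
    theta G (Phi σ (theta G D)) = Phi σ D := by
  have hσ' : ∀ a b, G.Adj (σ.symm a) (σ.symm b) ↔ G.Adj a b := by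
    intro a b; rw [← hσ]; simp
  obtain ⟨v, i, e⟩ := D
  have hsw : ∀ (τ : W ≃ ZMod (Fintype.card W)),
      (σ.trans (τ.trans (Equiv.swap i (i+1)))).trans (Equiv.swap i (i+1)) = σ.trans τ := by
    intro τ; ext a; simp
  by_cases h : G.Adj (v.symm i) (v.symm (i + 1))
  · have h1 : theta G (v, i, e) = (v.trans (Equiv.swap i (i+1)), i - epsZ _ e, !e) := by
      simp [theta, h]
    have h2 : Phi σ (theta G (v, i, e)) = (σ.trans (v.trans (Equiv.swap i (i+1))), i, e) := by
      rw [h1]; cases e <;> simp [Phi, epsZ]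
    rw [h2]
    have h3 : G.Adj ((σ.trans (v.trans (Equiv.swap i (i+1)))).symm i)
      ((σ.trans (v.trans (Equiv.swap i (i+1)))).symm (i+1)) := by
      simp [hσ', h.symm]
    unfold theta
    rw [if_pos h3]
    simp only [hsw]
    rfl
  · have h1 : theta G (v, i, e) = (v.trans (Equiv.swap i (i+1)), i + epsZ _ e, e) := by
      simp [theta, h]
    have h2 : Phi σ (theta G (v, i, e)) = (σ.trans (v.trans (Equiv.swap i (i+1))), i, !e) := by
      rw [h1]; cases e <;> simp [Phi, epsZ]
    rw [h2]
    have h3 : ¬ G.Adj ((σ.trans (v.trans (Equiv.swap i (i+1)))).symm i)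
      ((σ.trans (v.trans (Equiv.swap i (i+1)))).symm (i+1)) := by
      simp only [Equiv.symm_trans_apply, Equiv.symm_swap, Equiv.swap_apply_left,
        Equiv.swap_apply_right, hσ']
      exact fun h' => h h'.symm
    unfold theta
    rw [if_neg h3]
    simp only [hsw]
    cases e <;> simp [Phi, epsZ, sub_eq_add_neg]

lemma disp_phi (G : SimpleGraph W) (σ : Equiv.Perm W) (D : Xi W) (a : W) :
    disp (Phi σ (theta G D)) a = - disp D (σ a) := by
  have h1 := one_ne hn
  have hi : (Phi σ (theta G D)).2.1 = D.2.1 := by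
    obtain ⟨v, i, e⟩ := D
    unfold theta
    split_ifs <;> cases e <;> simp [Phi, epsZ]
  have hv : (Phi σ (theta G D)).1 a = Equiv.swap D.2.1 (D.2.1 + 1) (D.1 (σ a)) := by
    unfold theta
    split_ifs <;> simp [Phi]
  unfold disp
  rw [hi, hv]
  generalize D.1 (σ a) = p
  generalize D.2.1 = i
  by_cases hp : p = i
  · subst hp; simp [h1]
  by_cases hp' : p = i + 1
  · subst hp'; simp [h1]
  rw [Equiv.swap_apply_of_ne_of_ne hp hp']
  simp [hp, hp']

lemma S_phi_aux (G : SimpleGraph W) (σ : Equiv.Perm W)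
    (hσ : ∀ a b, G.Adj (σ a) (σ b) ↔ G.Adj a b) (D : Xi W) (P : ℕ) (a : W) :
    (theta G)^[P] (Phi σ ((theta G)^[P] D)) = Phi σ D ∧
    S G (Phi σ ((theta G)^[P] D)) P a = - S G D P (σ a) := by
  induction P with
  | zero => simp [S]
  | succ P ih =>
    have h1 : theta G (Phi σ ((theta G)^[P + 1] D)) = Phi σ ((theta G)^[P] D) := by
      rw [Function.iterate_succ_apply', theta_phi G σ hσ]
    constructor
    · rw [Function.iterate_succ_apply, h1, ih.1]
    · rw [add_comm P 1, S_add, add_comm 1 P, Function.iterate_one, h1, ih.2, S_add]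
      have h2 : ∀ E b, S G E 1 b = disp E b := by intro E b; simp [S]
      rw [h2, h2, Function.iterate_succ_apply', disp_phi hn]
      ring

lemma S_phi (G : SimpleGraph W) (σ : Equiv.Perm W)
    (hσ : ∀ a b, G.Adj (σ a) (σ b) ↔ G.Adj a b) (D : Xi W) (P : ℕ)
    (hP : (theta G)^[P] D = D) (a : W) :
    (theta G)^[P] (Phi σ D) = Phi σ D ∧ S G (Phi σ D) P a = - S G D P (σ a) := by
  have := S_phi_aux hn G σ hσ D P a
  rwa [hP] at this

omit hn in
/-- a direct transfer between twins makes the orbit symmetric -/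
lemma transfer_phi (G : SimpleGraph W) (D : Xi W) (h : G.Adj (stoneVertex D) (tgt D)) :
    theta G D = Phi (Equiv.swap (stoneVertex D) (tgt D)) D := by
  have h' := h
  rw [← adj_iff] at h
  have hv : D.1.trans (Equiv.swap D.2.1 (D.2.1 + 1)) =
      (Equiv.swap (stoneVertex D) (tgt D)).trans D.1 := by
    have h1 : D.1.trans (Equiv.swap D.2.1 (D.2.1 + 1)) = (theta G D).1 := by
      unfold theta; rw [if_pos h]
    rw [h1, theta_fst]
    ext a
    simp only [Equiv.trans_apply]
    by_cases ha : a = stoneVertex D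
    · subst ha; simp [tgt, stone_eq]
    by_cases hb : a = tgt D
    · subst hb; simp [tgt, stone_eq]
    rw [Equiv.swap_apply_of_ne_of_ne ha hb]
    rw [stone_eq, Equiv.eq_symm_apply] at ha
    rw [tgt, Equiv.eq_symm_apply] at hb
    rw [Equiv.swap_apply_of_ne_of_ne ha hb]
  unfold theta Phi
  rw [if_pos h, hv]

omit hn in
lemma twin_aut (G : SimpleGraph W) (K : W → Prop) (u : W)
    (hcl : ∀ a b, K a → K b → a ≠ b → G.Adj a b)
    (hcut : ∀ a b, K a → ¬ K b → G.Adj a b → a = u)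
    (b c : W) (Kb : K b) (Kc : K c) (hb : b ≠ u) (hc : c ≠ u) (x y : W) :
    G.Adj (Equiv.swap b c x) (Equiv.swap b c y) ↔ G.Adj x y := by
  have hN : ∀ d, K d → d ≠ u → ∀ a, G.Adj d a ↔ K a ∧ a ≠ d := by
    intro d Kd hd a
    constructor
    · intro h
      exact ⟨by_contra fun hK => hd (hcut d a Kd hK h), h.ne'⟩
    · rintro ⟨h1, h2⟩; exact hcl d a Kd h1 h2.symm
  have hbN := hN b Kb hb
  have hcN := hN c Kc hc
  have hbN' : ∀ a, G.Adj a b ↔ K a ∧ a ≠ b := fun a => by rw [G.adj_comm]; exact hbN a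
  have hcN' : ∀ a, G.Adj a c ↔ K a ∧ a ≠ c := fun a => by rw [G.adj_comm]; exact hcN a
  simp only [Equiv.swap_apply_def]
  split_ifs <;> simp_all

/-- Progress. -/
lemma progress (G : SimpleGraph W) (K : W → Prop) (u : W)
    (hcl : ∀ a b, K a → K b → a ≠ b → G.Adj a b)
    (hcut : ∀ a b, K a → ¬ K b → G.Adj a b → a = u) (d : ℕ) :
    ∀ D : Xi W, K (stoneVertex D) → stoneVertex D ≠ u → d + 1 < Fintype.card W →
    K (D.1.symm (pos D + dir D * ((d + 1 : ℕ)))) →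
    (∀ j, j ≤ d → D.1.symm (pos D + dir D * ((j + 1 : ℕ))) ≠ u) →
    ∃ k, K (stoneVertex ((theta G)^[k] D)) ∧ stoneVertex ((theta G)^[k] D) ≠ u ∧
      K (tgt ((theta G)^[k] D)) ∧ tgt ((theta G)^[k] D) ≠ u := by
  induction d with
  | zero =>
    intro D Ks hs hd Kt hu
    refine ⟨0, Ks, hs, ?_, ?_⟩
    · simpa [tgt] using Kt
    · simpa [tgt] using hu 0 le_rfl
  | succ d ih =>
    intro D Ks hs hd Kt hu
    by_cases Kt' : K (tgt D)
    · refine ⟨0, Ks, hs, Kt', ?_⟩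
      simpa [tgt] using hu 0 (by omega)
    · have hna : ¬ G.Adj (stoneVertex D) (tgt D) := fun h => hs (hcut _ _ Ks Kt' h)
      have hst := stone_nadj G D hna
      obtain ⟨hp, he⟩ := theta_nadj G D hna
      have hdir : dir (theta G D) = dir D := by unfold dir; rw [he]
      have hold : ∀ j, j ≤ d → (theta G D).1.symm (pos (theta G D) + dir (theta G D) * ((j + 1 : ℕ)))
          = D.1.symm (pos D + dir D * ((j + 1 + 1 : ℕ))) := by
        intro j hj
        rw [hp, hdir, theta_fst]
        simp only [Equiv.symm_trans_apply, Equiv.symm_swap]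
        congr 1
        have hcast : ∀ q : ℕ, 0 < q → q < Fintype.card W → (q : ZMod (Fintype.card W)) ≠ 0 := by
          intro q h0 hq h
          rw [ZMod.natCast_eq_zero_iff] at h
          exact absurd (Nat.le_of_dvd h0 h) (by omega)
        have hdm : ∀ q : ZMod (Fintype.card W), q ≠ 0 → dir D * q ≠ 0 := by
          intro q hq
          unfold dir epsZ; split_ifs <;> simpa
        have heq : pos D + dir D + dir D * ((j + 1 : ℕ)) = pos D + dir D * ((j + 1 + 1 : ℕ)) := by
          push_cast; ring
        rw [Equiv.swap_apply_of_ne_of_ne]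
        · exact heq
        · rw [heq]; intro h
          exact hdm _ (hcast (j+1+1) (by omega) (by omega)) (by simpa using h)
        · intro h
          exact hdm _ (hcast (j+1) (by omega) (by omega)) (by simpa using h)
      obtain ⟨k, hk⟩ := ih (theta G D) (by rw [hst]; exact Ks) (by rw [hst]; exact hs) (by omega)
        (by rw [hold d le_rfl]; exact Kt)
        (by intro j hj; rw [hold j hj]; exact hu (j+1) (by omega))
      exact ⟨k + 1, by simpa only [Function.iterate_succ_apply] using hk⟩

omit hn in
lemma offset (D : Xi W) (a : W) (h : 0 < Fintype.card W) :
    D.1.symm (pos D + ((D.1 a - pos D).val : ZMod (Fintype.card W))) = a := by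
  have : NeZero (Fintype.card W) := ⟨by omega⟩
  rw [ZMod.natCast_zmod_val]; simp

lemma exists_inv (K : W → Prop) (u : W) (D : Xi W) (Ks : K (stoneVertex D)) (Ku : K u)
    (hs : stoneVertex D ≠ u) (w : W) (Kw : K w) (hwu : w ≠ u) (hws : w ≠ stoneVertex D) :
    ∃ f, Inv K u D f := by
  have : NeZero (Fintype.card W) := ⟨by omega⟩
  set s := stoneVertex D with hsdef
  set g : W → ℕ := fun a => (D.1 a - pos D).val with hg
  have hgl : ∀ a, g a < Fintype.card W := fun a => ZMod.val_lt _
  have hginj : ∀ a b, g a = g b → a = b := by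
    intro a b h
    have := ZMod.val_injective _ h
    exact D.1.injective (by simpa using this)
  have hgs : g s = 0 := by simp [hg, hsdef, stone_eq]
  have hg0 : ∀ a, a ≠ s → 0 < g a := by
    intro a ha
    rcases Nat.eq_zero_or_pos (g a) with h | h
    · exact absurd (hginj a s (by omega)) ha
    · exact h
  let T : Finset W := Finset.univ.filter fun a => K a ∧ a ≠ s
  have hT : ∀ a, a ∈ T ↔ K a ∧ a ≠ s := by intro a; simp [T]
  have hTne : T.Nonempty := ⟨w, (hT w).2 ⟨Kw, hws⟩⟩
  obtain ⟨z, hz, hzmin⟩ := T.exists_min_image g hTne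
  obtain ⟨x, hx, hxmax⟩ := T.exists_max_image g hTne
  have hxz : g z < g x := by
    have h1 := hzmin w ((hT w).2 ⟨Kw, hws⟩)
    have h2 := hxmax w ((hT w).2 ⟨Kw, hws⟩)
    have h3 := hzmin u ((hT u).2 ⟨Ku, hs.symm⟩)
    have h4 := hxmax u ((hT u).2 ⟨Ku, hs.symm⟩)
    have h5 : g w ≠ g u := fun h => hwu (hginj _ _ h)
    omega
  rw [hT] at hz hx
  have hzx : z ≠ x := by rintro rfl; omega
  have hl0 : ∀ a, (((g a : ℤ) + (pos D).val : ℤ) : ZMod (Fintype.card W)) = D.1 a := by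
    intro a; simp [hg]
  refine ⟨fun a => (g a : ℤ) + (pos D).val - if a = x then (Fintype.card W : ℤ) else 0, ?_,
    x, s, z, hx.1, Ks, hz.1, ?_, ?_, ?_, ?_, fun _ => rfl, fun h => absurd Ks h⟩
  · intro a
    rw [Int.cast_sub, hl0]
    split_ifs <;> simp
  · have := hgl x
    simp [hx.2.symm, hgs]; omega
  · have := hg0 z hz.2
    simp [hx.2.symm, hgs, hzx]; omega
  · simp [hzx]; omega
  · intro a Ka hax has
    have h1 := hzmin a ((hT a).2 ⟨Ka, has⟩)
    have h2 := hxmax a ((hT a).2 ⟨Ka, has⟩)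
    have h3 : g a ≠ g x := fun h => hax (hginj _ _ h)
    simp [hzx, hax]; omega

/-- if the orbit contains a transfer -/
lemma of_transfer (G : SimpleGraph W) (K : W → Prop) (u : W) (Ku : K u)
    (hcl : ∀ a b, K a → K b → a ≠ b → G.Adj a b)
    (hcut : ∀ a b, K a → ¬ K b → G.Adj a b → a = u)
    (D : Xi W) (f : W → ℤ) (hf : Inv K u D f) (k : ℕ)
    (h : K (stoneVertex ((theta G)^[k] D)) ∧ stoneVertex ((theta G)^[k] D) ≠ u ∧
      K (tgt ((theta G)^[k] D)) ∧ tgt ((theta G)^[k] D) ≠ u)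
    (P : ℕ) (hP : (theta G)^[P] D = D) (a : W) : S G D P a = 0 := by
  obtain ⟨Ks, hs, Kt, ht⟩ := h
  set E := (theta G)^[k] D with hE
  have hPE : (theta G)^[P] E = E := per_shift G D P hP k
  have hadj := hcl _ _ Ks Kt (stone_ne_tgt hn E)
  have hphi := transfer_phi G E hadj
  have haut := twin_aut G K u hcl hcut _ _ Ks Kt hs ht
  have hsym : ∀ a, S G D P a = - S G D P (Equiv.swap (stoneVertex E) (tgt E) a) := by
    intro a
    have h1 := (S_phi hn G _ haut E P hPE a).2
    rw [← hphi] at h1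
    have h2 := S_shift G E P hPE 1 a
    rw [Function.iterate_one] at h2
    rw [h2, hE, S_shift G D P hP, S_shift G D P hP] at h1
    exact h1
  have hu : S G D P u = 0 := by
    have := hsym u
    rw [Equiv.swap_apply_of_ne_of_ne hs.symm ht.symm] at this
    omega
  by_cases has : a = stoneVertex E
  · rw [S_eq hn G K u hcl hcut D f hf P hP a u (has ▸ Ks) Ku, hu]
  by_cases hat : a = tgt E
  · rw [S_eq hn G K u hcl hcut D f hf P hP a u (hat ▸ Kt) Ku, hu]
  have := hsym a
  rw [Equiv.swap_apply_of_ne_of_ne has hat] at this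
  omega

lemma main (G : SimpleGraph W) (K : W → Prop) (u : W) (Ku : K u)
    (hcl : ∀ a b, K a → K b → a ≠ b → G.Adj a b)
    (hcut : ∀ a b, K a → ¬ K b → G.Adj a b → a = u)
    (D : Xi W) (Ks : K (stoneVertex D)) (hs : stoneVertex D ≠ u)
    (w : W) (Kw : K w) (hwu : w ≠ u) (hws : w ≠ stoneVertex D)
    (P : ℕ) (hP : (theta G)^[P] D = D) (a : W) : S G D P a = 0 := by
  have : NeZero (Fintype.card W) := ⟨by omega⟩
  -- a state with the good direction
  have good : ∀ D : Xi W, K (stoneVertex D) → stoneVertex D ≠ u → w ≠ stoneVertex D →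
      (if D.2.2 then (D.1 w - pos D).val < (D.1 u - pos D).val
        else (D.1 u - pos D).val < (D.1 w - pos D).val) →
      ∀ P, (theta G)^[P] D = D → ∀ a, S G D P a = 0 := by
    intro D Ks hs hws hdir P hP a
    obtain ⟨f, hf⟩ := exists_inv hn K u D Ks Ku hs w Kw hwu hws
    have hk1 : (D.1 w - pos D).val < Fintype.card W := ZMod.val_lt _
    have hl1 : (D.1 u - pos D).val < Fintype.card W := ZMod.val_lt _
    have hk0 : (D.1 w - pos D).val ≠ 0 := by
      rw [ne_eq, ZMod.val_eq_zero, sub_eq_zero]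
      intro h; apply hws; rw [stone_eq, ← h]; simp
    have hl0 : (D.1 u - pos D).val ≠ 0 := by
      rw [ne_eq, ZMod.val_eq_zero, sub_eq_zero]
      intro h; apply hs; rw [stone_eq, ← h]; simp
    have hwo := offset D w (by omega)
    have huo := offset D u (by omega)
    set k := (D.1 w - pos D).val with hk
    set l := (D.1 u - pos D).val with hl
    have hne : ∀ j : ℕ, j < Fintype.card W → j ≠ l →
        D.1.symm (pos D + (j : ZMod (Fintype.card W))) ≠ u := by
      intro j hj hjl h
      rw [← huo] at h
      have h2 := add_left_cancel (D.1.symm.injective h)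
      rw [ZMod.natCast_eq_natCast_iff'] at h2
      rw [Nat.mod_eq_of_lt hj, Nat.mod_eq_of_lt hl1] at h2
      exact hjl h2
    by_cases he : D.2.2 = true
    · rw [if_pos he] at hdir
      have hd : dir D = 1 := by simp [dir, epsZ, he]
      obtain ⟨q, hq⟩ := progress hn G K u hcl hcut (k - 1) D Ks hs (by omega)
        (by rw [hd, one_mul, Nat.sub_add_cancel (by omega), hwo]; exact Kw)
        (by intro j hj; rw [hd, one_mul]; exact hne _ (by omega) (by omega))
      exact of_transfer hn G K u Ku hcl hcut D f hf q hq P hP a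
    · rw [if_neg he] at hdir
      have hd : dir D = -1 := by simp [dir, epsZ, he]
      have hneg : ∀ j : ℕ, j ≤ Fintype.card W → dir D * (j : ZMod (Fintype.card W)) =
          ((Fintype.card W - j : ℕ) : ZMod (Fintype.card W)) := by
        intro j hj; rw [hd, Nat.cast_sub hj]; simp
      obtain ⟨q, hq⟩ := progress hn G K u hcl hcut (Fintype.card W - k - 1) D Ks hs (by omega)
        (by
          rw [hneg _ (by omega), show Fintype.card W - (Fintype.card W - k - 1 + 1) = k by omega, hwo]
          exact Kw)
        (by intro j hj; rw [hneg _ (by omega)]; exact hne _ (by omega) (by omega))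
      exact of_transfer hn G K u Ku hcl hcut D f hf q hq P hP a
  by_cases hc : (if D.2.2 then (D.1 w - pos D).val < (D.1 u - pos D).val
        else (D.1 u - pos D).val < (D.1 w - pos D).val)
  · exact good D Ks hs hws hc P hP a
  · have hpos : pos (Phi 1 D) = pos D := by
      obtain ⟨v, i, e⟩ := D
      cases e <;> simp [Phi, pos, epsZ]
    have h1 : (Phi 1 D).1 = D.1 := by ext a; simp [Phi]
    have h2 : (Phi 1 D).2.2 = !D.2.2 := rfl
    have hst : stoneVertex (Phi 1 D) = stoneVertex D := by rw [stone_eq, stone_eq, hpos, h1]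
    have hne : (D.1 w - pos D).val ≠ (D.1 u - pos D).val := by
      intro h
      have := ZMod.val_injective _ h
      exact hwu (D.1.injective (by simpa using this))
    have hp := S_phi hn G 1 (by intro a b; rfl) D P hP a
    have := good (Phi 1 D) (by rwa [hst]) (by rwa [hst]) (by rwa [hst])
      (by
        rw [hpos, h1, h2]
        cases h : D.2.2 <;> simp [h] at hc ⊢ <;> omega) P hp.1 a
    rw [this] at hp
    have := hp.2
    simp at this
    exact this

end big

end RTP

/-- Let `G` be a wedge of a graph `H` with the complete graph `K_m`
(`m ≥ 3`), where the vertex `v₁` of `K_m` is identified with the vertex `u` of `H` (the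
remaining vertices of `K_m` are the `Sum.inr` vertices).  If `D₀` is a state in which the
stone coexists with the replica of some vertex `v_j` of `K_m` with `j ≥ 2`, then the orbit
of `Θ_G` containing `D₀` has winding vector `0`. -/
theorem stmt_9 {V : Type*} [Fintype V] (m : ℕ) (hm : 3 ≤ m)
    (H : SimpleGraph V) (u : V) (v₁ : Fin m)
    (D₀ : Xi (V ⊕ {y : Fin m // y ≠ v₁}))
    (hstone : ∃ j : {y : Fin m // y ≠ v₁}, stoneVertex D₀ = Sum.inr j) :
    WindingVectorZero (wedge H (⊤ : SimpleGraph (Fin m)) u v₁) D₀ := by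
  obtain ⟨j, hj⟩ := hstone
  obtain ⟨c, hc1, hc2⟩ : ∃ c : Fin m, c ≠ v₁ ∧ c ≠ j.1 := by
    have : ∃ c ∈ (Finset.univ : Finset (Fin m)), c ∉ ({v₁, j.1} : Finset (Fin m)) := by
      apply Finset.exists_mem_notMem_of_card_lt_card
      have := Finset.card_le_two (a := v₁) (b := j.1)
      simp only [Finset.card_univ, Fintype.card_fin]; omega
    obtain ⟨c, -, hc⟩ := this
    simp at hc
    exact ⟨c, hc.1, hc.2⟩
  let c' : {y : Fin m // y ≠ v₁} := ⟨c, hc1⟩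
  have hcj : c' ≠ j := fun h => hc2 (congrArg Subtype.val h)
  have hn : 3 ≤ Fintype.card (V ⊕ {y : Fin m // y ≠ v₁}) := by
    have h : ({Sum.inl u, Sum.inr c', Sum.inr j} : Finset (V ⊕ {y : Fin m // y ≠ v₁})).card = 3 := by
      rw [Finset.card_eq_three]
      exact ⟨_, _, _, by simp, by simp, by simpa using hcj, rfl⟩
    rw [← h]; exact Finset.card_le_univ _
  intro a
  refine RTP.main hn (wedge H (⊤ : SimpleGraph (Fin m)) u v₁)
    (fun x => x = Sum.inl u ∨ ∃ k, x = Sum.inr k) (Sum.inl u) (Or.inl rfl) ?_ ?_ D₀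
    (Or.inr ⟨j, hj⟩) (by rw [hj]; simp) (Sum.inr c') (Or.inr ⟨_, rfl⟩) (by simp)
    (by rw [hj]; simpa using hcj) _ (Function.iterate_minimalPeriod) a
  · rintro x y (rfl | ⟨k, rfl⟩) (rfl | ⟨l, rfl⟩) hne
    · exact absurd rfl hne
    · simp [wedge, l.2.symm]
    · simp [wedge, k.2.symm]
    · have hkl : k ≠ l := fun h => hne (by rw [h])
      have : k.1 ≠ l.1 := fun h => hkl (Subtype.ext h)
      simp [wedge, hkl, this]
  · rintro x y (rfl | ⟨k, rfl⟩) hy hadj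
    · rfl
    · exfalso
      rcases y with b | l
      · simp [wedge] at hadj
        exact hy (Or.inl (by rw [hadj.1]))
      · exact hy (Or.inr ⟨l, rfl⟩)
end

section
/- For every m ≥ 3, the wedge of the complete graph K_m with any tree (identifying a vertex of K_m with a vertex of the tree) is ensnaring. -/
open scoped Classical

/-- `G` is ensnaring if every orbit of `Θ_G` has winding vector `0`. -/
def Ensnaring {V : Type*} [Fintype V] (G : SimpleGraph V) : Prop :=
  ∀ D : Xi V, WindingVectorZero G D

/-- `G` is expelling if no orbit of `Θ_G` has winding vector `0`. -/
def Expelling {V : Type*} [Fintype V] (G : SimpleGraph V) : Prop :=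
  ∀ D : Xi V, ¬ WindingVectorZero G D

namespace RTP

section slots
variable {V : Type*} [Fintype V]

set_option linter.unusedSectionVars false

inductive Step (G : SimpleGraph V) (N : ℤ) :
    (V → ℤ) × V × ℤ → (V → ℤ) × V × ℤ → Prop
  | pass (Y : V → ℤ) (c : V) (e : ℤ) (b : V) (hb : b ≠ c) (hd : N ∣ Y b - (Y c + e))
      (ha : ¬ G.Adj c b) : Step G N (Y, c, e) (Y + Pi.single c e, c, e)
  | hit (Y : V → ℤ) (c : V) (e : ℤ) (b : V) (hb : b ≠ c) (hd : N ∣ Y b - (Y c + e))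
      (ha : G.Adj c b) : Step G N (Y, c, e) (Y + Pi.single c e, b, -e)

abbrev Reach (G : SimpleGraph V) (N : ℤ) := Relation.ReflTransGen (Step G N)

def Valid (N : ℤ) (Y : V → ℤ) (c : V) : Prop :=
  ∀ z : ℤ, ∃ b, b ≠ c ∧ N ∣ Y b - z ∧ ∀ b', b' ≠ c → N ∣ Y b' - z → b' = b

structure Rooted (G : SimpleGraph V) (core : V → Prop) (par : V → V) (d : V → ℕ) : Prop where
  clique : ∀ x y, core x → core y → x ≠ y → G.Adj x y
  adj_par : ∀ x, ¬ core x → G.Adj x (par x)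
  d_par : ∀ x, ¬ core x → d (par x) < d x
  cases : ∀ x y, G.Adj x y → (core x ∧ core y) ∨ (¬ core x ∧ par x = y) ∨ (¬ core y ∧ par y = x)

theorem Valid.congr {N : ℤ} {Y Y' : V → ℤ} {c : V} (h : Valid N Y c)
    (hY : ∀ x, x ≠ c → N ∣ Y' x - Y x) : Valid N Y' c := by
  intro z
  obtain ⟨b, hb, hd, hu⟩ := h z
  refine ⟨b, hb, ?_, ?_⟩
  · have := dvd_add (hY b hb) hd
    simpa using this
  · intro b' hb' hd'
    refine hu b' hb' ?_
    have := dvd_sub hd' (hY b' hb')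
    have e : Y' b' - z - (Y' b' - Y b') = Y b' - z := by ring
    rwa [e] at this

theorem Valid.inj {N : ℤ} {Y : V → ℤ} {c : V} (h : Valid N Y c) {x y : V} (hx : x ≠ c)
    (hy : y ≠ c) {z : ℤ} (h1 : N ∣ Y x - z) (h2 : N ∣ Y y - z) : x = y := by
  obtain ⟨b, hb, hd, hu⟩ := h z
  rw [hu x hx h1, hu y hy h2]

theorem Valid.swap {N : ℤ} {Y : V → ℤ} {c b : V} (h : Valid N Y c) (hb : b ≠ c)
    (hd : N ∣ Y b - Y c) : Valid N Y b := by
  intro z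
  obtain ⟨x, hx, hxd, hu⟩ := h z
  by_cases hxb : x = b
  · subst hxb
    refine ⟨c, hb.symm, ?_, ?_⟩
    · have := dvd_sub hxd hd
      have e : Y x - z - (Y x - Y c) = Y c - z := by ring
      rwa [e] at this
    · intro b' hb' hd'
      by_contra hc
      exact hb' (hu b' hc hd')
  · refine ⟨x, hxb, hxd, ?_⟩
    intro b' hb' hd'
    by_cases hc : b' = c
    · subst hc
      exfalso
      have := dvd_add hd hd'
      have e : Y b - Y b' + (Y b' - z) = Y b - z := by ring
      rw [e] at this
      exact hxb (hu b hb this).symm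
    · exact hu b' hc hd'

noncomputable def FF (core : V → Prop) (par : V → V) (H : V → V → ℤ) (N : ℤ) (Y : V → ℤ)
    (c : V) (z : ℤ) : V → ℤ :=
  ∑ x, if (¬ core x ∧ par x = c) ∧ N ∣ Y x - z then H x else 0

def Exc (G : SimpleGraph V) (N : ℤ) (a b : V) (h : V → ℤ) : Prop :=
  ∀ (Y : V → ℤ) (e : ℤ), e * e = 1 → Valid N Y b → N ∣ Y b - Y a →
    Reach G N (Y, b, e) (Y + (N * e) • h, a, -e)

theorem run {G : SimpleGraph V} {core : V → Prop} {par : V → V} {d : V → ℕ}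
    (R : Rooted G core par d) {N : ℤ} (H : V → V → ℤ) (c : V)
    (hH : ∀ x, ¬ core x → par x = c → Exc G N c x (H x))
    (Y : V → ℤ) (e : ℤ) (he : e * e = 1) (hv : Valid N Y c) (k : ℕ)
    (hk : ∀ j : ℕ, j < k → ∀ x, x ≠ c → N ∣ Y x - (Y c + e * (j + 1)) → G.Adj c x →
      ¬ core x ∧ par x = c) :
    Reach G N (Y, c, e)
      (Y + Pi.single c (e * k) - (N * e) • ∑ j ∈ Finset.range k,
        FF core par H N Y c (Y c + e * (j + 1)), c, e) := by
  induction k with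
  | zero => simpa using Relation.ReflTransGen.refl
  | succ k ih =>
    have ih := ih (fun j hj => hk j (by omega))
    refine ih.trans ?_
    rw [Finset.sum_range_succ]
    set S := ∑ j ∈ Finset.range k, FF core par H N Y c (Y c + e * (j + 1)) with hS
    set Y1 := Y + Pi.single c (e * (k : ℤ)) - (N * e) • S with hY1
    have hY1x : ∀ x, x ≠ c → Y1 x = Y x - N * e * S x := by
      intro x hx
      simp [hY1, hx]
    have hY1c : Y1 c = Y c + e * k - N * e * S c := by
      simp [hY1]
    obtain ⟨x, hxc, hxd, hxu⟩ := hv (Y c + e * (k + 1))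
    have hd : N ∣ Y1 x - (Y1 c + e) := by
      rw [hY1x x hxc, hY1c]
      obtain ⟨q, hq⟩ := hxd
      exact ⟨q - e * S x + e * S c, by linear_combination hq⟩
    by_cases ha : G.Adj c x
    · obtain ⟨hcx, hpx⟩ := hk k (by omega) x hxc hxd ha
      have hF : FF core par H N Y c (Y c + e * (k + 1)) = H x := by
        unfold FF
        rw [Finset.sum_eq_single x]
        · rw [if_pos ⟨⟨hcx, hpx⟩, hxd⟩]
        · intro y _ hyx
          rw [if_neg]
          rintro ⟨⟨h1, h2⟩, h3⟩
          refine hyx (hxu y ?_ h3)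
          rintro rfl
          exact (R.adj_par y h1).ne h2.symm
        · simp
      rw [hF]
      refine (Relation.ReflTransGen.single (Step.hit Y1 c e x hxc hd ha)).trans ?_
      have hv1 : Valid N (Y1 + Pi.single c e) c := by
        refine hv.congr ?_
        intro y hy
        simp only [Pi.add_apply, Pi.single_eq_of_ne hy, hY1x y hy]
        exact ⟨- (e * S y), by ring⟩
      have hd1 : N ∣ (Y1 + Pi.single c e : V → ℤ) x - (Y1 + Pi.single c e : V → ℤ) c := by
        simpa [Pi.single_eq_of_ne hxc] using hd
      have := hH x hcx hpx (Y1 + Pi.single c e) (-e) (by simpa using he)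
        (hv1.swap hxc hd1) hd1
      rw [neg_neg] at this
      convert this using 2
      rw [hY1]
      ext y
      by_cases hy : y = c
      · subst hy; simp; ring
      · simp [hy]; ring
    · have hF : FF core par H N Y c (Y c + e * (k + 1)) = 0 := by
        unfold FF
        refine Finset.sum_eq_zero ?_
        intro y _
        rw [if_neg]
        rintro ⟨⟨h1, h2⟩, h3⟩
        have hadj := R.adj_par y h1
        rw [h2] at hadj
        have := hxu y hadj.ne h3
        subst this
        exact ha hadj.symm
      rw [hF]
      convert Relation.ReflTransGen.single (Step.pass Y1 c e x hxc hd ha) using 2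
      rw [hY1]
      ext y
      by_cases hy : y = c
      · subst hy; simp; ring
      · simp [hy]

/-- exists a positive number of steps to reach a slot -/
theorem exists_steps {N : ℤ} (hN : 0 < N) (e : ℤ) (he : e * e = 1) (y z : ℤ) :
    ∃ j : ℕ, (j : ℤ) < N ∧ N ∣ y - (z + e * (j + 1)) := by
  have h1 := Int.emod_nonneg (e * (y - z) - 1) hN.ne'
  have h2 := Int.emod_lt_of_pos (e * (y - z) - 1) hN
  have h3 := Int.mul_ediv_add_emod (e * (y - z) - 1) N
  refine ⟨((e * (y - z) - 1) % N).toNat, by omega, ?_⟩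
  rw [Int.toNat_of_nonneg h1]
  exact ⟨e * ((e * (y - z) - 1) / N), by linear_combination (z - y) * he - e * h3⟩

theorem step_unique {N : ℤ} (e : ℤ) (he : e * e = 1) {y z : ℤ} {i j : ℕ}
    (hi : (i : ℤ) < N) (hj : (j : ℤ) < N)
    (h1 : N ∣ y - (z + e * (i + 1))) (h2 : N ∣ y - (z + e * (j + 1))) : i = j := by
  have h3 : N ∣ (i : ℤ) - j := by
    obtain ⟨p, hp⟩ := h1
    obtain ⟨q, hq⟩ := h2
    exact ⟨e * (q - p), by linear_combination e * hq - e * hp - ((i : ℤ) - j) * he⟩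
  have := Int.eq_zero_of_abs_lt_dvd h3 (by rw [abs_lt]; constructor <;> omega)
  omega

theorem exc_exists {G : SimpleGraph V} {core : V → Prop} {par : V → V} {d : V → ℕ}
    (R : Rooted G core par d) {N : ℤ} (hN : 0 < N) :
    ∃ H : V → V → ℤ, ∀ x, ¬ core x → Exc G N (par x) x (H x) := by
  suffices h : ∀ x, ¬ core x → ∃ h, Exc G N (par x) x h by
    choose! H hH using h
    exact ⟨H, hH⟩
  obtain ⟨M, hM⟩ : ∃ M, ∀ x, d x ≤ M :=
    ⟨Finset.univ.sup d, fun x => Finset.le_sup (Finset.mem_univ x)⟩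
  suffices h : ∀ k x, M - d x ≤ k → ¬ core x → ∃ h, Exc G N (par x) x h from
    fun x => h _ x le_rfl
  intro k
  induction k using Nat.strong_induction_on with
  | _ k ih =>
  intro b hbk hb
  have hch : ∀ x, ¬ core x → par x = b → ∃ h, Exc G N b x h := by
    intro x hx hpx
    have h1 := R.d_par x hx
    rw [hpx] at h1
    have h2 := hM x
    have := ih (M - d x) (by omega) x le_rfl hx
    rwa [hpx] at this
  choose! H hH using hch
  refine ⟨Pi.single b 1 - ∑ x, if ¬ core x ∧ par x = b then H x else 0, ?_⟩
  intro Y e he hv hab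
  set a := par b with ha
  have hadj : G.Adj b a := R.adj_par b hb
  have hanb : a ≠ b := hadj.ne'
  obtain ⟨n, rfl⟩ : ∃ n : ℕ, N = n + 1 := ⟨(N - 1).toNat, by omega⟩
  have hslot : ∀ j : ℕ, j < n → ¬ ((n : ℤ) + 1 ∣ Y a - (Y b + e * (j + 1))) := by
    intro j hj hd
    have h2 : (n : ℤ) + 1 ∣ Y a - (Y b + e * (n + 1)) := by
      obtain ⟨q, hq⟩ := hab
      exact ⟨-q - e, by linear_combination -hq⟩
    have := step_unique e he (by omega) (by omega) hd h2
    omega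
  have hrun := run R H b hH Y e he hv n (by
    intro j hj x hx hd hA
    have hxa : x ≠ a := by
      rintro rfl
      exact hslot j hj hd
    rcases R.cases b x hA with h | h | h
    · exact absurd h.1 hb
    · exact absurd h.2.symm hxa
    · exact h)
  have hsum : ∑ j ∈ Finset.range n, FF core par H (n + 1) Y b (Y b + e * (j + 1)) =
      ∑ x, if ¬ core x ∧ par x = b then H x else 0 := by
    unfold FF
    rw [Finset.sum_comm]
    refine Finset.sum_congr rfl ?_
    intro x _
    by_cases hx : ¬ core x ∧ par x = b
    · simp only [if_pos hx]
      obtain ⟨j, hj, hjd⟩ := exists_steps hN e he (Y x) (Y b)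
      have hxb : x ≠ b := by
        rintro rfl
        exact (R.adj_par x hx.1).ne hx.2.symm
      have hjn : j < n := by
        by_contra hcon
        have hjn : j = n := by omega
        subst hjn
        have h2 : (j : ℤ) + 1 ∣ Y a - (Y b + e * (j + 1)) := by
          obtain ⟨q, hq⟩ := hab
          exact ⟨-q - e, by linear_combination -hq⟩
        have hxa := hv.inj hxb hanb hjd h2
        have h3 := R.d_par x hx.1
        have h4 := R.d_par b hb
        rw [hx.2] at h3
        rw [← ha, ← hxa] at h4
        omega
      rw [Finset.sum_eq_single j]
      · rw [if_pos ⟨hx, hjd⟩]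
      · intro i hi hij
        rw [if_neg]
        rintro ⟨_, hid⟩
        have := Finset.mem_range.mp hi
        exact hij (step_unique e he (by omega) hj hid hjd)
      · intro h
        exact absurd (Finset.mem_range.mpr hjn) h
    · refine (Finset.sum_eq_zero ?_).trans (if_neg hx).symm
      intro j _
      rw [if_neg]
      exact fun h => hx h.1
  rw [hsum] at hrun
  refine hrun.trans ?_
  set S := ∑ x, if ¬ core x ∧ par x = b then H x else 0
  set Y1 := Y + Pi.single b (e * (n : ℤ)) - (((n : ℤ) + 1) * e) • S with hY1
  have hd : (n : ℤ) + 1 ∣ Y1 a - (Y1 b + e) := by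
    simp only [hY1, Pi.add_apply, Pi.sub_apply, Pi.single_eq_same, Pi.single_eq_of_ne hanb,
      Pi.smul_apply, smul_eq_mul]
    obtain ⟨q, hq⟩ := hab
    exact ⟨-q - e * S a + e * S b - e, by linear_combination -hq⟩
  convert Relation.ReflTransGen.single (Step.hit Y1 b e a hanb hd hadj) using 2
  rw [hY1]
  ext y
  by_cases hy : y = b
  · subst hy; simp; ring
  · simp [hy]; ring

theorem run_hit {G : SimpleGraph V} {core : V → Prop} {par : V → V} {d : V → ℕ}
    (R : Rooted G core par d) {N : ℤ} (H : V → V → ℤ) (c : V)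
    (hH : ∀ x, ¬ core x → par x = c → Exc G N c x (H x))
    (Y : V → ℤ) (e : ℤ) (he : e * e = 1) (hv : Valid N Y c) (k : ℕ)
    (hk : ∀ j : ℕ, j < k → ∀ x, x ≠ c → N ∣ Y x - (Y c + e * (j + 1)) → G.Adj c x →
      ¬ core x ∧ par x = c)
    (b : V) (hA : G.Adj c b) (hb : N ∣ Y b - (Y c + e * (k + 1)))
    (Y' : V → ℤ) (hY' : Y' = Y + Pi.single c (e * (k + 1)) - (N * e) • ∑ j ∈ Finset.range k,
        FF core par H N Y c (Y c + e * (j + 1))) :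
    Relation.TransGen (Step G N) (Y, c, e) (Y', b, -e) ∧ Valid N Y' b ∧ N ∣ Y' c - Y' b := by
  have hr := run R H c hH Y e he hv k hk
  set S := ∑ j ∈ Finset.range k, FF core par H N Y c (Y c + e * (j + 1)) with hS
  set Y1 := Y + Pi.single c (e * (k : ℤ)) - (N * e) • S with hY1
  have hbc : b ≠ c := hA.ne'
  have hd : N ∣ Y1 b - (Y1 c + e) := by
    obtain ⟨q, hq⟩ := hb
    refine ⟨q - e * S b + e * S c, ?_⟩
    simp [hY1, hbc]
    linear_combination hq
  have hYY : Y' = Y1 + Pi.single c e := by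
    rw [hY', hY1]
    ext y
    by_cases hy : y = c
    · subst hy; simp; ring
    · simp [hy]
  have h1 : N ∣ Y' b - Y' c := by
    rw [hYY]
    simpa [Pi.single_eq_of_ne hbc] using hd
  refine ⟨?_, ?_, ?_⟩
  · rw [hYY]
    exact Relation.TransGen.tail' hr (Step.hit Y1 c e b hbc hd hA)
  · refine Valid.swap (hv.congr ?_) hbc h1
    intro x hx
    refine ⟨- e * S x, ?_⟩
    rw [hY']
    simp [hx]
    ring
  · rw [← dvd_neg, neg_sub]
    exact h1

structure PP (core : V → Prop) (par : V → V) (H : V → V → ℤ) (N : ℤ) (k : ℕ) (T0 : V → V → ℤ)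
    (Y : V → ℤ) (a b c : V) (e : ℤ) : Prop where
  ca : core a
  cb : core b
  cc : core c
  ab : a ≠ b
  bc : b ≠ c
  ac : a ≠ c
  he : e * e = 1
  hv : Valid N Y a
  hc : N ∣ Y c - Y a
  hb : N ∣ Y b - (Y a + e * (k + 1))
  hbet : ∀ j : ℕ, j < k → ∀ x, x ≠ a → N ∣ Y x - (Y a + e * (j + 1)) → ¬ core x
  hT : ∀ x, ∑ j ∈ Finset.range k, FF core par H N Y x (Y a + e * (j + 1)) = T0 x

theorem dvd_iff_of {N a b : ℤ} (h : N ∣ a - b) : N ∣ a ↔ N ∣ b := by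
  constructor
  · intro h1
    have := dvd_sub h1 h
    simpa using this
  · intro h1
    have := dvd_add h h1
    simpa using this

theorem FF_congr (core : V → Prop) (par : V → V) (H : V → V → ℤ) (N : ℤ) (Y Y' : V → ℤ)
    (c : V) (z z' : ℤ) (h : ∀ x, ¬ core x → N ∣ Y x - Y' x) (hz : N ∣ z - z') :
    FF core par H N Y c z = FF core par H N Y' c z' := by
  unfold FF
  refine Finset.sum_congr rfl ?_
  intro x _
  by_cases hx : ¬ core x ∧ par x = c
  · have : N ∣ Y x - z ↔ N ∣ Y' x - z' := by
      apply dvd_iff_of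
      have := dvd_sub (h x hx.1) hz
      have e : Y x - Y' x - (z - z') = Y x - z - (Y' x - z') := by ring
      rwa [e] at this
    simp only [hx, this]
  · rw [if_neg (fun h => hx h.1), if_neg (fun h => hx h.1)]

theorem PP.phase {G : SimpleGraph V} {core : V → Prop} {par : V → V} {d : V → ℕ}
    (R : Rooted G core par d) {N : ℤ} {H : V → V → ℤ}
    (hH : ∀ x, ¬ core x → Exc G N (par x) x (H x)) {k : ℕ} {T0 : V → V → ℤ}
    {Y : V → ℤ} {a b c : V} {e : ℤ} (P : PP core par H N k T0 Y a b c e)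
    (Y' : V → ℤ) (hY' : Y' = Y + Pi.single a (e * (k + 1)) - (N * e) • T0 a) :
    Relation.TransGen (Step G N) (Y, a, e) (Y', b, -e) ∧
      PP core par H N k T0 Y' b c a (-e) := by
  have hY'x : ∀ x, x ≠ a → Y' x = Y x - N * e * T0 a x := by
    intro x hx
    simp [hY', hx]
  have hY'a : Y' a = Y a + e * (k + 1) - N * e * T0 a a := by
    simp [hY']
  obtain ⟨h1, h2, h3⟩ := run_hit R H a (by
      intro x hx hp
      have := hH x hx
      rwa [hp] at this) Y e P.he P.hv k (by
      intro j hj x hx hd hA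
      have hx' := P.hbet j hj x hx hd
      rcases R.cases a x hA with h | h | h
      · exact absurd h.2 hx'
      · exact absurd P.ca h.1
      · exact h) b (R.clique a b P.ca P.cb P.ab) P.hb Y' (by rw [P.hT a, hY'])
  refine ⟨h1, P.cb, P.cc, P.ca, P.bc, P.ac.symm, P.ab.symm, by simpa using P.he, h2, h3, ?_, ?_, ?_⟩
  · rw [hY'x b P.ab.symm, hY'x c P.ac.symm]
    obtain ⟨p, hp⟩ := P.hc
    obtain ⟨q, hq⟩ := P.hb
    exact ⟨p - q - e * T0 a c + e * T0 a b, by linear_combination hp - hq⟩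
  · intro j hj x hx hd hcx
    have hkj : ((k - 1 - j : ℕ) : ℤ) = k - 1 - j := by omega
    obtain ⟨q, hq⟩ := P.hb
    obtain ⟨s, hs⟩ := hd
    rw [hY'x b P.ab.symm] at hs
    by_cases hxa : x = a
    · subst hxa
      refine P.hbet j hj c P.ac.symm ?_ P.cc
      obtain ⟨p, hp⟩ := P.hc
      rw [hY'a] at hs
      exact ⟨p - s - q + e * T0 x b - e * T0 x x, by linear_combination hp - hs - hq⟩
    · rw [hY'x x hxa] at hs
      refine P.hbet (k - 1 - j) (by omega) x hxa ?_ hcx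
      rw [hkj]
      exact ⟨s + q - e * T0 a b + e * T0 a x, by linear_combination hs + hq⟩
  · intro x
    rw [← P.hT x, ← Finset.sum_range_reflect]
    refine Finset.sum_congr rfl ?_
    intro j hj
    have hj := Finset.mem_range.mp hj
    have hkj : ((k - 1 - j : ℕ) : ℤ) = k - 1 - j := by omega
    apply FF_congr
    · intro y hy
      have hya : y ≠ a := by
        rintro rfl
        exact hy P.ca
      rw [hY'x y hya]
      exact ⟨- (e * T0 a y), by ring⟩
    · rw [hkj, hY'x b P.ab.symm]
      obtain ⟨q, hq⟩ := P.hb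
      exact ⟨q - e * T0 a b, by linear_combination hq⟩

theorem PP.cycle {G : SimpleGraph V} {core : V → Prop} {par : V → V} {d : V → ℕ}
    (R : Rooted G core par d) {N : ℤ} {H : V → V → ℤ}
    (hH : ∀ x, ¬ core x → Exc G N (par x) x (H x)) {k : ℕ} {T0 : V → V → ℤ}
    {Y : V → ℤ} {a b c : V} {e : ℤ} (P : PP core par H N k T0 Y a b c e) :
    Relation.TransGen (Step G N) (Y, a, e) (Y, a, e) := by
  obtain ⟨r1, P1⟩ := P.phase R hH _ rfl
  obtain ⟨r2, P2⟩ := P1.phase R hH _ rfl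
  obtain ⟨r3, P3⟩ := P2.phase R hH _ rfl
  obtain ⟨r4, P4⟩ := P3.phase R hH _ rfl
  obtain ⟨r5, P5⟩ := P4.phase R hH _ rfl
  obtain ⟨r6, P6⟩ := P5.phase R hH Y (by
    ext y
    by_cases h1 : y = a
    · subst h1; simp [P.ab, P.ac]; ring
    · by_cases h2 : y = b
      · subst h2; simp [P.bc, h1]; ring
      · by_cases h3 : y = c
        · subst h3; simp [h2, h1]; ring
        · simp [h1, h2, h3]; ring)
  have := ((((r1.trans r2).trans r3).trans r4).trans r5).trans r6
  simpa using this

theorem reach_core {G : SimpleGraph V} {core : V → Prop} {par : V → V} {d : V → ℕ}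
    (R : Rooted G core par d) {N : ℤ} (hN : 0 < N) {H : V → V → ℤ}
    (hH : ∀ x, ¬ core x → Exc G N (par x) x (H x)) (k : ℕ) :
    ∀ (Y : V → ℤ) (c : V) (e : ℤ), d c ≤ k → e * e = 1 → Valid N Y c →
      ∃ Y' c' e', Reach G N (Y, c, e) (Y', c', e') ∧ core c' ∧ e' * e' = 1 ∧ Valid N Y' c' := by
  induction k with
  | zero =>
    intro Y c e hk he hv
    by_cases hc : core c
    · exact ⟨Y, c, e, Relation.ReflTransGen.refl, hc, he, hv⟩
    · have := R.d_par c hc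
      omega
  | succ k ih =>
    intro Y c e hk he hv
    by_cases hc : core c
    · exact ⟨Y, c, e, Relation.ReflTransGen.refl, hc, he, hv⟩
    have hex : ∃ j : ℕ, N ∣ Y (par c) - (Y c + e * (j + 1)) := by
      obtain ⟨j, _, hj⟩ := exists_steps hN e he (Y (par c)) (Y c)
      exact ⟨j, hj⟩
    have hmin := fun j => Nat.find_min (H := hex) (m := j)
    obtain ⟨h1, h2, h3⟩ := run_hit R H c (by
      intro x hx hp
      have := hH x hx
      rwa [hp] at this) Y e he hv (Nat.find hex) (by
      intro j hj x hx hd hA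
      rcases R.cases c x hA with h | h | h
      · exact absurd h.1 hc
      · refine absurd ?_ (hmin j hj)
        rwa [h.2]
      · exact h) (par c) (R.adj_par c hc) (Nat.find_spec hex) _ rfl
    have := R.d_par c hc
    obtain ⟨Y', c', e', r, hh⟩ := ih _ (par c) (-e) (by omega) (by simpa using he) h2
    exact ⟨Y', c', e', h1.to_reflTransGen.trans r, hh⟩

/-- From a core carrier, run to the next core vertex. -/
theorem next_core {G : SimpleGraph V} {core : V → Prop} {par : V → V} {d : V → ℕ}
    (R : Rooted G core par d) {N : ℤ} (hN : 0 < N) {H : V → V → ℤ}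
    (hH : ∀ x, ¬ core x → Exc G N (par x) x (H x))
    (hcore : ∀ a c, ∃ b, core b ∧ b ≠ a ∧ b ≠ c)
    (Y : V → ℤ) (a : V) (e : ℤ) (ha : core a) (he : e * e = 1) (hv : Valid N Y a) :
    ∃ Y' b, Reach G N (Y, a, e) (Y', b, -e) ∧ core b ∧ a ≠ b ∧ Valid N Y' b ∧
      N ∣ Y' a - Y' b := by
  have hex : ∃ j : ℕ, ∃ b, core b ∧ b ≠ a ∧ N ∣ Y b - (Y a + e * (j + 1)) := by
    obtain ⟨b, hb, hba, _⟩ := hcore a a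
    obtain ⟨j, _, hj⟩ := exists_steps hN e he (Y b) (Y a)
    exact ⟨j, b, hb, hba, hj⟩
  have hmin := fun j => Nat.find_min (H := hex) (m := j)
  obtain ⟨b, hb, hba, hbd⟩ := Nat.find_spec hex
  obtain ⟨h1, h2, h3⟩ := run_hit R H a (by
      intro x hx hp
      have := hH x hx
      rwa [hp] at this) Y e he hv (Nat.find hex) (by
      intro j hj x hx hd hA
      rcases R.cases a x hA with h | h | h
      · exact absurd ⟨x, h.2, hx, hd⟩ (hmin j hj)
      · exact absurd ha h.1
      · exact h) b (R.clique a b ha hb hba.symm) hbd _ rfl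
  exact ⟨_, b, h1.to_reflTransGen, hb, hba.symm, h2, h3⟩

theorem PP_exists {core : V → Prop} {par : V → V}
    {N : ℤ} (hN : 0 < N) {H : V → V → ℤ}
    (hcore : ∀ a c, ∃ b, core b ∧ b ≠ a ∧ b ≠ c)
    (Y : V → ℤ) (a c : V) (e : ℤ) (ha : core a) (hc : core c) (hac : a ≠ c)
    (he : e * e = 1) (hv : Valid N Y a) (hd : N ∣ Y c - Y a) :
    ∃ k T0 b, PP core par H N k T0 Y a b c e := by
  have hex : ∃ j : ℕ, ∃ b, core b ∧ b ≠ a ∧ N ∣ Y b - (Y a + e * (j + 1)) :=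
    by
    obtain ⟨b, hb, hba, _⟩ := hcore a a
    obtain ⟨j, _, hj⟩ := exists_steps hN e he (Y b) (Y a)
    exact ⟨j, b, hb, hba, hj⟩
  have hmin := fun j => Nat.find_min (H := hex) (m := j)
  have hle := fun j => Nat.find_min' (H := hex) (m := j)
  obtain ⟨b, hb, hba, hbd⟩ := Nat.find_spec hex
  set k := Nat.find hex
  have hbc : b ≠ c := by
    rintro rfl
    obtain ⟨f, hf, hfa, hfb⟩ := hcore a b
    obtain ⟨j, hj, hjd⟩ := exists_steps hN e he (Y f) (Y a)
    have h1 := hle j ⟨f, hf, hfa, hjd⟩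
    obtain ⟨n, rfl⟩ : ∃ n : ℕ, N = n + 1 := ⟨(N - 1).toNat, by omega⟩
    have h2 : (n : ℤ) + 1 ∣ Y b - (Y a + e * (n + 1)) := by
      obtain ⟨q, hq⟩ := hd
      exact ⟨q - e, by linear_combination hq⟩
    have h3 := step_unique e he (by omega) (by omega) hbd h2
    have h4 : j = k := by omega
    subst h4
    exact hfb (hv.inj hfa hba hjd hbd)
  refine ⟨k, _, b, ha, hb, hc, hba.symm, hbc, hac, he, hv, hd, hbd, ?_, fun x => rfl⟩
  intro j hj x hx hdx hcx
  exact hmin j hj ⟨x, hcx, hx, hdx⟩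

theorem slot_main {G : SimpleGraph V} {core : V → Prop} {par : V → V} {d : V → ℕ}
    (R : Rooted G core par d) {N : ℤ} (hN : 0 < N)
    (hcore : ∀ a c, ∃ b, core b ∧ b ≠ a ∧ b ≠ c)
    (Y : V → ℤ) (c : V) (e : ℤ) (he : e * e = 1) (hv : Valid N Y c) :
    ∃ s, Reach G N (Y, c, e) s ∧ Relation.TransGen (Step G N) s s := by
  obtain ⟨H, hH⟩ := exc_exists R hN
  obtain ⟨Y1, c1, e1, r1, hc1, he1, hv1⟩ := reach_core R hN hH (d c) Y c e le_rfl he hv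
  obtain ⟨Y2, b, r2, hb, hne, hv2, hd2⟩ := next_core R hN hH hcore Y1 c1 e1 hc1 he1 hv1
  obtain ⟨k, T0, f, P⟩ := PP_exists (par := par) (H := H) hN hcore Y2 b c1 (-e1) hb hc1 hne.symm
    (by simpa using he1) hv2 hd2
  exact ⟨_, r1.trans r2, P.cycle R hH⟩

end slots

section sim
variable {V : Type*} [Fintype V]

structure Sim (D : Xi V) (X Y : V → ℤ) (c : V) (e : ℤ) : Prop where
  pos : ∀ x, D.1 x = ((X x : ℤ) : ZMod (Fintype.card V))
  dir : (e = 1 ∧ D.2.2 = true ∧ D.1 c = D.2.1) ∨ (e = -1 ∧ D.2.2 = false ∧ D.1 c = D.2.1 + 1)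
  rel : ∀ x, x ≠ c → ∃ q r : ℤ, 1 ≤ r ∧ r ≤ (Fintype.card V : ℤ) - 1 ∧
    e * (Y x - Y c) = ((Fintype.card V : ℤ) - 1) * q + r ∧
    e * (X x - X c) = (Fintype.card V : ℤ) * q + r

theorem theta_pos (G : SimpleGraph V) (D : Xi V) (x : V) :
    (theta G D).1 x = D.1 x + ((disp D x : ℤ) : ZMod (Fintype.card V)) := by
  have h : (theta G D).1 x = Equiv.swap D.2.1 (D.2.1 + 1) (D.1 x) := by
    unfold theta
    split_ifs <;> rfl
  rw [h]
  unfold disp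
  split_ifs with h1 h2
  · rw [h1]; simp
  · rw [h2]; simp
  · rw [Equiv.swap_apply_of_ne_of_ne h1 h2]; simp

theorem Sim.step {G : SimpleGraph V} (hn : 3 ≤ Fintype.card V) {D : Xi V} {X Y : V → ℤ} {c : V}
    {e : ℤ} (S : Sim D X Y c e) {Y' : V → ℤ} {c' : V} {e' : ℤ}
    (h : Step G ((Fintype.card V : ℤ) - 1) (Y, c, e) (Y', c', e')) :
    Sim (theta G D) (X + disp D) Y' c' e' ∧ ∑ x, disp D x = 0 := by
  have key : ∀ b, b ≠ c → ((Fintype.card V : ℤ) - 1) ∣ Y b - (Y c + e) →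
      (disp D = Pi.single c e - Pi.single b e ∧
      (∃ q : ℤ, e * (Y b - Y c) = ((Fintype.card V : ℤ) - 1) * q + 1 ∧
        e * (X b - X c) = (Fintype.card V : ℤ) * q + 1) ∧
      (∀ x, x ≠ c → x ≠ b → ∃ q r : ℤ, 2 ≤ r ∧ r ≤ (Fintype.card V : ℤ) - 1 ∧
        e * (Y x - Y c) = ((Fintype.card V : ℤ) - 1) * q + r ∧
        e * (X x - X c) = (Fintype.card V : ℤ) * q + r)) ∧
      ((G.Adj (D.1.symm D.2.1) (D.1.symm (D.2.1 + 1)) ↔ G.Adj c b) ∧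
        D.1 b = D.1 c + ((e : ℤ) : ZMod (Fintype.card V))) := by
    intro b hb hd
    have he : e * e = 1 := by
      rcases S.dir with ⟨h, _⟩ | ⟨h, _⟩ <;> simp [h]
    have hpos1 : ∀ x q, e * (X x - X c) = (Fintype.card V : ℤ) * q + 1 →
        D.1 x = D.1 c + ((e : ℤ) : ZMod (Fintype.card V)) := by
      intro x q hq
      rw [S.pos x, S.pos c]
      have : X x = X c + e + (Fintype.card V : ℤ) * (e * q) := by
        linear_combination e * hq - (X x - X c) * he
      rw [this]
      push_cast
      simp
    obtain ⟨q, r, hr1, hr2, hY, hX⟩ := S.rel b hb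
    have hr : r = 1 := by
      obtain ⟨p, hp⟩ := hd
      have : ((Fintype.card V : ℤ) - 1) ∣ r - 1 :=
        ⟨e * p - q, by linear_combination e * hp - hY + he⟩
      have := Int.eq_zero_of_abs_lt_dvd this (by rw [abs_lt]; constructor <;> omega)
      omega
    subst hr
    have hDb := hpos1 b q hX
    have hbc : D.1 b ≠ D.1 c := fun h => hb (D.1.injective h)
    refine ⟨⟨?_, ⟨q, hY, hX⟩, ?_⟩, ?_, hDb⟩
    · ext x
      unfold disp
      rcases S.dir with ⟨h1, _, h2⟩ | ⟨h1, _, h2⟩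
      · have h3 : D.1 b = D.2.1 + 1 := by rw [hDb, h1, h2]; simp
        rw [← h3, ← h2, h1]
        simp only [D.1.injective.eq_iff]
        by_cases hxc : x = c
        · subst hxc; simp [hb.symm]
        · by_cases hxb : x = b
          · subst hxb; simp [hb]
          · simp [hxc, hxb]
      · have h3 : D.1 b = D.2.1 := by rw [hDb, h1, h2]; simp
        rw [← h2, ← h3, h1]
        simp only [D.1.injective.eq_iff]
        by_cases hxc : x = c
        · subst hxc; simp [hb.symm]
        · by_cases hxb : x = b
          · subst hxb; simp [hb]
          · simp [hxc, hxb]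
    · intro x hxc hxb
      obtain ⟨q', r', hr1', hr2', hY', hX'⟩ := S.rel x hxc
      refine ⟨q', r', ?_, hr2', hY', hX'⟩
      by_contra hcon
      have : r' = 1 := by omega
      subst this
      exact hxb (D.1.injective ((hpos1 x q' hX').trans hDb.symm))
    · rcases S.dir with ⟨h1, _, h2⟩ | ⟨h1, _, h2⟩
      · have h3 : D.1 b = D.2.1 + 1 := by rw [hDb, h1, h2]; simp
        rw [← h3, ← h2]
        simp
      · have h3 : D.1 b = D.2.1 := by rw [hDb, h1, h2]; simp
        rw [← h2, ← h3]
        simp [G.adj_comm]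
  have hpos : ∀ x, (theta G D).1 x = (((X + disp D) x : ℤ) : ZMod (Fintype.card V)) := by
    intro x
    rw [theta_pos, S.pos x]
    simp
  cases h with
  | pass _ _ _ b hb hd ha =>
    obtain ⟨⟨hdisp, ⟨q, hYb, hXb⟩, hrel⟩, hadj, hDb⟩ := key b hb hd
    refine ⟨⟨hpos, ?_, ?_⟩, ?_⟩
    · rw [theta_pos, hdisp]
      unfold theta
      rw [if_neg (by rwa [hadj])]
      rcases S.dir with ⟨h1, h4, h2⟩ | ⟨h1, h4, h2⟩
      · left
        refine ⟨h1, h4, ?_⟩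
        simp [h1, h2, h4, epsZ, hb.symm]
      · right
        refine ⟨h1, h4, ?_⟩
        simp [h1, h2, h4, epsZ, hb.symm]
    · intro x hx
      have he : e * e = 1 := by
        rcases S.dir with ⟨h, _⟩ | ⟨h, _⟩ <;> simp [h]
      rw [hdisp]
      by_cases hxb : x = b
      · subst hxb
        refine ⟨q - 1, (Fintype.card V : ℤ) - 1, by omega, le_rfl, ?_, ?_⟩
        · simp [hx]
          linear_combination hYb - he
        · simp [hx, hx.symm]
          linear_combination hXb - 2 * he
      · obtain ⟨q', r', hr1', hr2', hY', hX'⟩ := hrel x hx hxb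
        refine ⟨q', r' - 1, by omega, by omega, ?_, ?_⟩
        · simp [hx]
          linear_combination hY' - he
        · simp [hx, hxb, hb.symm]
          linear_combination hX' - he
    · rw [hdisp]; simp
  | hit _ _ _ b hb hd ha =>
    obtain ⟨⟨hdisp, ⟨q, hYb, hXb⟩, hrel⟩, hadj, hDb⟩ := key _ hb hd
    refine ⟨⟨hpos, ?_, ?_⟩, ?_⟩
    · rw [theta_pos, hdisp, hDb]
      unfold theta
      rw [if_pos (by rwa [hadj])]
      rcases S.dir with ⟨h1, h4, h2⟩ | ⟨h1, h4, h2⟩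
      · right
        refine ⟨by simp [h1], by simp [h4], ?_⟩
        simp [h1, h2, h4, epsZ, hb]
      · left
        refine ⟨by simp [h1], by simp [h4], ?_⟩
        simp [h1, h2, h4, epsZ, hb]
    · intro x hx
      have he : e * e = 1 := by
        rcases S.dir with ⟨h, _⟩ | ⟨h, _⟩ <;> simp [h]
      rw [hdisp]
      by_cases hxb : x = c
      · subst hxb
        refine ⟨q - 1, (Fintype.card V : ℤ) - 1, by omega, le_rfl, ?_, ?_⟩
        · simp [hb]
          linear_combination hYb - he
        · simp [hx, hx.symm]
          linear_combination hXb - 2 * he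
      · obtain ⟨q', r', hr1', hr2', hY', hX'⟩ := hrel x hxb hx
        refine ⟨q - q' - 1, Fintype.card V - r', by omega, by omega, ?_, ?_⟩
        · simp [hxb, hb]
          linear_combination hYb - hY'
        · simp [hx, hxb, hb]
          linear_combination hXb - hX' - he
    · rw [hdisp]; simp

theorem Sim.transGen {G : SimpleGraph V} (hn : 3 ≤ Fintype.card V) {D : Xi V} {X : V → ℤ}
    {s t : (V → ℤ) × V × ℤ} (S : Sim D X s.1 s.2.1 s.2.2)
    (h : Relation.TransGen (Step G ((Fintype.card V : ℤ) - 1)) s t) :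
    ∃ K : ℕ, 0 < K ∧ Sim ((theta G)^[K] D)
      (X + ∑ j ∈ Finset.range K, disp ((theta G)^[j] D)) t.1 t.2.1 t.2.2 ∧
      ∑ x, ∑ j ∈ Finset.range K, disp ((theta G)^[j] D) x = 0 := by
  induction h with
  | single h =>
    obtain ⟨h1, h2⟩ := S.step hn h
    exact ⟨1, one_pos, by simpa using h1, by simpa using h2⟩
  | tail _ h ih =>
    obtain ⟨K, hK, S', hs⟩ := ih
    obtain ⟨h1, h2⟩ := S'.step hn h
    refine ⟨K + 1, by omega, ?_, ?_⟩
    · rw [Function.iterate_succ_apply', Finset.sum_range_succ, ← add_assoc]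
      exact h1
    · simp only [Finset.sum_range_succ, Finset.sum_add_distrib, hs, h2, add_zero]

theorem Sim.eq {D D' : Xi V} {X X' Y : V → ℤ} {c : V} {e : ℤ}
    (S : Sim D X Y c e) (S' : Sim D' X' Y c e) (hn : 3 ≤ Fintype.card V)
    (hs : ∑ x, X x = ∑ x, X' x) : X = X' ∧ D = D' := by
  have he : e * e = 1 := by
    rcases S.dir with ⟨h, _⟩ | ⟨h, _⟩ <;> simp [h]
  have h1 : ∀ x, X x - X' x = X c - X' c := by
    intro x
    by_cases hx : x = c
    · rw [hx]
    obtain ⟨q, r, a1, a2, a3, a4⟩ := S.rel x hx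
    obtain ⟨q', r', b1, b2, b3, b4⟩ := S'.rel x hx
    have hr : r = r' := by
      have : ((Fintype.card V : ℤ) - 1) ∣ r - r' :=
        ⟨q' - q, by linear_combination b3 - a3⟩
      have := Int.eq_zero_of_abs_lt_dvd this (by rw [abs_lt]; constructor <;> omega)
      omega
    subst hr
    have hq : q = q' := by
      have h0 : ((Fintype.card V : ℤ) - 1) ≠ 0 := by omega
      apply mul_left_cancel₀ h0
      linear_combination b3 - a3
    subst hq
    linear_combination e * a4 - e * b4 - (X x - X c - X' x + X' c) * he
  have h2 : ∑ x : V, (X x - X' x) = 0 := by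
    rw [Finset.sum_sub_distrib, hs, sub_self]
  simp only [h1] at h2
  simp only [Finset.sum_const, Finset.card_univ, nsmul_eq_mul] at h2
  have h3 : X c - X' c = 0 := by
    have hc0 : (Fintype.card V : ℤ) ≠ 0 := by omega
    apply mul_left_cancel₀ hc0
    linear_combination h2
  have hX : X = X' := by
    ext x
    have := h1 x
    omega
  refine ⟨hX, ?_⟩
  have hD1 : D.1 = D'.1 := by
    ext x
    rw [S.pos x, S'.pos x, hX]
  obtain ⟨v, i, b⟩ := D
  obtain ⟨v', i', b'⟩ := D'
  simp only at hD1
  subst hD1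
  rcases S.dir with ⟨p1, p2, p3⟩ | ⟨p1, p2, p3⟩ <;>
    rcases S'.dir with ⟨q1, q2, q3⟩ | ⟨q1, q2, q3⟩
  · simp only at p2 p3 q2 q3
    rw [p2, q2, ← p3, ← q3]
  · omega
  · omega
  · simp only at p2 p3 q2 q3
    have : i = i' := by
      rw [p3] at q3
      exact add_right_cancel q3
    rw [p2, q2, this]

theorem exists_sim (hn : 3 ≤ Fintype.card V) (D : Xi V) :
    ∃ X Y c e, e * e = 1 ∧ Sim D X Y c e ∧ Valid ((Fintype.card V : ℤ) - 1) Y c := by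
  have : NeZero (Fintype.card V) := ⟨by omega⟩
  obtain ⟨c, e, he, hdir⟩ : ∃ (c : V) (e : ℤ), e * e = 1 ∧
      ((e = 1 ∧ D.2.2 = true ∧ D.1 c = D.2.1) ∨
        (e = -1 ∧ D.2.2 = false ∧ D.1 c = D.2.1 + 1)) := by
    cases h : D.2.2
    · exact ⟨D.1.symm (D.2.1 + 1), -1, by norm_num, Or.inr (by simp)⟩
    · exact ⟨D.1.symm D.2.1, 1, by norm_num, Or.inl (by simp)⟩
  set r : V → ℤ := fun x => (((e : ZMod (Fintype.card V)) * (D.1 x - D.1 c)).val : ℤ) with hr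
  have heZ : (e : ZMod (Fintype.card V)) * e = 1 := by
    have := congrArg (Int.cast : ℤ → ZMod (Fintype.card V)) he
    simpa using this
  have hrc : r c = 0 := by simp [hr]
  have hrcast : ∀ x, ((r x : ℤ) : ZMod (Fintype.card V)) =
      (e : ZMod (Fintype.card V)) * (D.1 x - D.1 c) := by
    intro x
    simp [hr]
  have hrinj : ∀ x y, r x = r y → x = y := by
    intro x y h
    have h2 : ((r x : ℤ) : ZMod (Fintype.card V)) = r y := by rw [h]
    rw [hrcast, hrcast] at h2
    apply D.1.injective
    linear_combination (e : ZMod (Fintype.card V)) * h2 - (D.1 x - D.1 y) * heZ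
  have hr0 : ∀ x, x ≠ c → 1 ≤ r x := by
    intro x hx
    have h0 : 0 ≤ r x := Int.natCast_nonneg _
    have h1 : r x ≠ 0 := fun h => hx (hrinj x c (by rw [h, hrc]))
    omega
  have hrlt : ∀ x, r x ≤ (Fintype.card V : ℤ) - 1 := by
    intro x
    have := ZMod.val_lt ((e : ZMod (Fintype.card V)) * (D.1 x - D.1 c))
    simp only [hr]
    omega
  refine ⟨fun x => ((D.1 c).val : ℤ) + e * r x, fun x => e * r x, c, e, he, ⟨?_, hdir, ?_⟩, ?_⟩
  · intro x
    push_cast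
    rw [hrcast]
    simp only [ZMod.natCast_val, ZMod.cast_id', id]
    linear_combination -(D.1 x - D.1 c) * heZ
  · intro x hx
    refine ⟨0, r x, hr0 x hx, hrlt x, ?_, ?_⟩
    · simp only [hrc]
      linear_combination r x * he
    · simp only [hrc]
      linear_combination r x * he
  · intro z
    obtain ⟨j, hj, hjd⟩ := exists_steps (N := (Fintype.card V : ℤ) - 1) (by omega) 1 (by norm_num)
      (e * z) 0
    set b := D.1.symm (D.1 c + (e : ZMod (Fintype.card V)) * ((j + 1 : ℕ) : ZMod (Fintype.card V)))
      with hb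
    have hrb : r b = j + 1 := by
      have : (e : ZMod (Fintype.card V)) * (D.1 b - D.1 c) = ((j + 1 : ℕ) : ZMod (Fintype.card V)) := by
        rw [hb]
        simp only [Equiv.apply_symm_apply]
        linear_combination ((j + 1 : ℕ) : ZMod (Fintype.card V)) * heZ
      simp only [hr]
      rw [this, ZMod.val_natCast_of_lt (by omega)]
      push_cast
      rfl
    have hbc : b ≠ c := by
      intro h
      rw [h, hrc] at hrb
      omega
    have hbd : (Fintype.card V : ℤ) - 1 ∣ e * r b - z := by
      rw [hrb]
      obtain ⟨q, hq⟩ := hjd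
      exact ⟨-e * q, by linear_combination -e * hq + z * he⟩
    refine ⟨b, hbc, hbd, ?_⟩
    intro b' hb' hd'
    apply hrinj
    have h3 : (Fintype.card V : ℤ) - 1 ∣ r b' - r b := by
      obtain ⟨p, hp⟩ := hbd
      obtain ⟨q, hq⟩ := hd'
      exact ⟨e * (q - p), by linear_combination e * hq - e * hp - (r b' - r b) * he⟩
    have h4 := hr0 b hbc
    have h5 := hr0 b' hb'
    have h6 := hrlt b
    have h7 := hrlt b'
    have := Int.eq_zero_of_abs_lt_dvd h3 (by rw [abs_lt]; constructor <;> omega)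
    omega

theorem sum_period {α : Type*} (f : α → α) (x : α) (g : α → ℤ) (p : ℕ) (hp : f^[p] x = x) (k : ℕ) :
    ∑ j ∈ Finset.range (p * k), g (f^[j] x) = k * ∑ j ∈ Finset.range p, g (f^[j] x) := by
  induction k with
  | zero => simp
  | succ k ih =>
    rw [Nat.mul_succ, Finset.sum_range_add, ih]
    have : ∀ j, f^[p * k + j] x = f^[j] x := by
      intro j
      rw [add_comm, Function.iterate_add_apply]
      congr 1
      exact (Function.IsPeriodicPt.mul_const (show Function.IsPeriodicPt f p x from hp) k)
    simp only [this]
    push_cast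
    ring

theorem sum_shift {α : Type*} (f : α → α) (x : α) (g : α → ℤ) (p : ℕ) (hp : f^[p] x = x) (k : ℕ) :
    ∑ j ∈ Finset.range p, g (f^[j] (f^[k] x)) = ∑ j ∈ Finset.range p, g (f^[j] x) := by
  induction k with
  | zero => simp
  | succ k ih =>
    rw [← ih, Function.iterate_succ_apply']
    set y := f^[k] x
    have hy : f^[p] y = y := by
      rw [← Function.iterate_add_apply, add_comm, Function.iterate_add_apply, hp]
    have h1 := Finset.sum_range_succ (fun j => g (f^[j] y)) p
    have h2 := Finset.sum_range_succ' (fun j => g (f^[j] y)) p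
    simp only [Function.iterate_succ_apply, hy, Function.iterate_zero, id] at h1 h2
    linarith

theorem ensnaring_of_rooted {G : SimpleGraph V} {core : V → Prop} {par : V → V} {d : V → ℕ}
    (R : Rooted G core par d) (hn : 3 ≤ Fintype.card V)
    (hcore : ∀ a c, ∃ b, core b ∧ b ≠ a ∧ b ≠ c) : Ensnaring G := by
  intro D a
  unfold windSum
  by_cases hper : D ∈ Function.periodicPts (theta G)
  swap
  · rw [Function.minimalPeriod_eq_zero_of_notMem_periodicPts hper]
    simp
  obtain ⟨X, Y, c, e, he, S, hv⟩ := exists_sim hn D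
  obtain ⟨s, r1, r2⟩ := slot_main R (N := (Fintype.card V : ℤ) - 1) (by omega) hcore Y c e he hv
  obtain ⟨k, X1, S1⟩ : ∃ k X1, Sim ((theta G)^[k] D) X1 s.1 s.2.1 s.2.2 := by
    rcases Relation.reflTransGen_iff_eq_or_transGen.mp r1 with h | h
    · subst h
      exact ⟨0, X, S⟩
    · obtain ⟨K, _, S', _⟩ := Sim.transGen hn (s := (Y, c, e)) S h
      exact ⟨K, _, S'⟩
  obtain ⟨K, hK, S2, hs⟩ := S1.transGen hn r2
  set D1 := (theta G)^[k] D with hD1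
  obtain ⟨hX, hD⟩ := S1.eq S2 hn (by
    simp only [Pi.add_apply, Finset.sum_add_distrib, Finset.sum_apply]
    rw [hs, add_zero])
  have hz : ∑ j ∈ Finset.range K, disp ((theta G)^[j] D1) a = 0 := by
    have := congrFun hX a
    simpa using this
  have hmp : Function.minimalPeriod (theta G) D1 = Function.minimalPeriod (theta G) D :=
    Function.minimalPeriod_apply_iterate hper k
  have hdvd : Function.minimalPeriod (theta G) D1 ∣ K :=
    Function.IsPeriodicPt.minimalPeriod_dvd hD.symm
  obtain ⟨l, hl⟩ := hdvd
  have h1 := sum_period (theta G) D1 (fun E => disp E a) _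
    (Function.iterate_minimalPeriod (f := theta G) (x := D1)) l
  rw [← hl, hz, hmp] at h1
  have h2 := sum_shift (theta G) D (fun E => disp E a) _
    (Function.iterate_minimalPeriod (f := theta G) (x := D)) k
  rw [← hD1] at h2
  rw [h2] at h1
  have hl0 : (l : ℤ) ≠ 0 := by
    rintro h
    have : l = 0 := by exact_mod_cast h
    subst this
    omega
  rcases mul_eq_zero.mp h1.symm with h | h
  · exact absurd h hl0
  · exact h

end sim

end RTP

theorem RTP.tree_par {V : Type*} (T : SimpleGraph V) (hT : T.IsTree) (u : V) :
    ∃ (par : V → V) (d : V → ℕ), (∀ y, y ≠ u → T.Adj y (par y) ∧ d (par y) < d y) ∧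
      ∀ x y, T.Adj x y → (x ≠ u ∧ par x = y) ∨ (y ≠ u ∧ par y = x) := by
  have hex := fun y => (hT.existsUnique_path u y).exists
  choose p hp using hex
  have key : ∀ x y, T.Adj x y → x ∈ (p y).support → y ≠ u ∧ (p y).penultimate = x ∧
      (p x).length < (p y).length := by
    intro x y hA hx
    have h := hT.isAcyclic.path_concat (hp x) (hp y) hA hx
    refine ⟨?_, ?_, ?_⟩
    · rintro rfl
      have h0 := SimpleGraph.Walk.nil_iff_length_eq.mp (SimpleGraph.Walk.isPath_iff_nil.mp (hp y))
      have h1 := congrArg SimpleGraph.Walk.length h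
      rw [h0, SimpleGraph.Walk.length_concat] at h1
      omega
    · rw [h]; simp
    · rw [h]; simp
  refine ⟨fun y => (p y).penultimate, fun y => (p y).length, ?_, ?_⟩
  · intro y hy
    have hnil : ¬ (p y).Nil := SimpleGraph.Walk.not_nil_of_ne hy.symm
    have hA := SimpleGraph.Walk.adj_penultimate hnil
    exact ⟨hA.symm, (key _ y hA (SimpleGraph.Walk.getVert_mem_support _ _)).2.2⟩
  · intro x y hA
    by_cases hx : x ∈ (p y).support
    · exact Or.inr ⟨(key x y hA hx).1, (key x y hA hx).2.1⟩
    · have hy : y ∈ (p x).support :=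
        hT.isAcyclic.mem_support_of_ne_mem_support_of_adj_of_isPath (hp x) (hp y) hA hx
      exact Or.inl ⟨(key y x hA.symm hy).1, (key y x hA.symm hy).2.1⟩

theorem RTP.wedge_rooted {V : Type*} [DecidableEq V] (m : ℕ)
    (T : SimpleGraph V) (hT : T.IsTree) (v₁ : Fin m) (u : V) :
    ∃ par d, RTP.Rooted (wedge (⊤ : SimpleGraph (Fin m)) T v₁ u)
      (fun x => x.isLeft = true) par d := by
  obtain ⟨par, d, h1, h2⟩ := RTP.tree_par T hT u
  let f : V → Fin m ⊕ {y : V // y ≠ u} := fun y =>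
    if h : y = u then Sum.inl v₁ else Sum.inr ⟨y, h⟩
  refine ⟨fun x => Sum.elim (fun a => Sum.inl a) (fun y => f (par y.1)) x,
    fun x => Sum.elim (fun _ => 0) (fun y => d y.1 + 1) x, ?_, ?_, ?_, ?_⟩
  · rintro (x | x) (y | y) hx hy hxy
    · have : x ≠ y := fun h => hxy (by rw [h])
      simp [wedge, this]
    all_goals simp at hx hy
  · rintro (x | x) hx
    · simp at hx
    · have := (h1 x.1 x.2).1
      by_cases h : par x.1 = u
      · rw [h] at this
        simp [f, h, wedge, this.symm]
      · have hne : x ≠ ⟨par x.1, h⟩ := fun h' => this.ne (congrArg Subtype.val h')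
        simp [f, h, wedge, this, hne]
  · rintro (x | x) hx
    · simp at hx
    · have := (h1 x.1 x.2).2
      by_cases h : par x.1 = u
      · simp [f, h]
      · simp [f, h, this]
  · rintro (x | x) (y | y) hA
    · left; simp
    · right; right
      simp [wedge] at hA
      obtain ⟨rfl, hA⟩ := hA
      rcases h2 _ _ hA with h | h
      · exact absurd rfl h.1
      · simp [f, h.2]
    · right; left
      simp [wedge] at hA
      obtain ⟨rfl, hA⟩ := hA
      rcases h2 _ _ hA with h | h
      · exact absurd rfl h.1
      · simp [f, h.2]
    · right
      have hA' : T.Adj x.1 y.1 := by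
        simp [wedge] at hA
        rcases hA.2 with h | h
        · exact h
        · exact h.symm
      rcases h2 _ _ hA' with h | h
      · left; simp [f, h.2, y.2]
      · right; simp [f, h.2, x.2]

/-- For every `m ≥ 3`, the wedge of the complete graph `K_m` with any
tree (identifying a vertex `v₁` of `K_m` with a vertex `u` of the tree) is ensnaring. -/
theorem stmt_10 {V : Type*} [Fintype V] [DecidableEq V] (m : ℕ) (hm : 3 ≤ m)
    (T : SimpleGraph V) (hT : T.IsTree) (v₁ : Fin m) (u : V) :
    Ensnaring (wedge (⊤ : SimpleGraph (Fin m)) T v₁ u) := by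
  obtain ⟨par, d, R⟩ := RTP.wedge_rooted m T hT v₁ u
  refine RTP.ensnaring_of_rooted R ?_ ?_
  · rw [Fintype.card_sum, Fintype.card_fin]
    omega
  · intro a c
    obtain ⟨b, hb⟩ : ∃ b : Fin m, b ∉ ({a.elim id (fun _ => v₁), c.elim id (fun _ => v₁)} :
        Finset (Fin m)) := by
      by_contra hcon
      push Not at hcon
      have h1 := Finset.card_le_card (fun b (_ : b ∈ (Finset.univ : Finset (Fin m))) => hcon b)
      have h2 := Finset.card_le_two (a := a.elim id (fun _ => v₁)) (b := c.elim id (fun _ => v₁))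
      rw [Finset.card_univ, Fintype.card_fin] at h1
      omega
    simp only [Finset.mem_insert, Finset.mem_singleton, not_or] at hb
    refine ⟨Sum.inl b, rfl, ?_, ?_⟩
    · rintro rfl
      exact hb.1 rfl
    · rintro rfl
      exact hb.2 rfl
end
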